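/- Let Ω be a bounded domain in ℝ^N satisfying the uniform exterior sphere condition at every point of its boundary Γ (there exists R > 0 such that for every x₀ ∈ Γ there is a ball B_R(y₀) with closure of B_R(y₀) ∩ closure of Ω = {x₀}), and fix 1 < p ≤ ∞. Then there exists 0 < ε_Γ ≤ ε₀ such that for every 0 < ε < ε_Γ, all points of Γ are regular for the Dirichlet-type problem; in particular, for every g ∈ C(Γ), the problem u = μ_p^ε[u] in Ω, u = g on Γ admits a unique solution u^ε = u̲^ε = u̅^ε ∈ C(closure of Ω). -/

import Mathlib

open MeasureTheory Filter Topology Metric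
open scoped ENNReal

noncomputable section

/-- The variational `p`-mean predicate: `m` minimizes the (normalized) `L^p` distance of `v`
to constants, with respect to the measure `μ`. -/
def IsPMean {N : ℕ} (p : ℝ≥0∞) (μ : Measure (EuclideanSpace ℝ (Fin N)))
    (v : EuclideanSpace ℝ (Fin N) → ℝ) (m : ℝ) : Prop :=
  ∀ ν : ℝ, eLpNorm (fun x => v x - m) p μ ≤ eLpNorm (fun x => v x - ν) p μ

/-- The `p`-mean of `v` with respect to `μ` (chosen among the minimizers). -/
def pMean {N : ℕ} (p : ℝ≥0∞) (μ : Measure (EuclideanSpace ℝ (Fin N)))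
    (v : EuclideanSpace ℝ (Fin N) → ℝ) : ℝ :=
  Classical.epsilon (IsPMean p μ v)

/-- `r_ε(x) = min (ε, dist(x, ∂Ω))`. -/
def rEps {N : ℕ} (ε : ℝ) (Ω : Set (EuclideanSpace ℝ (Fin N))) (x : EuclideanSpace ℝ (Fin N)) : ℝ :=
  min ε (Metric.infDist x (frontier Ω))

open Classical in
/-- The operator `μ_p^ε`: the `p`-mean of `v` on the ball `B_{r_ε(x)}(x)` for `x ∈ Ω`,
and `v x` itself outside of `Ω` (in particular on the boundary, where `r_ε = 0`). -/
def muEps {N : ℕ} (p : ℝ≥0∞) (ε : ℝ) (Ω : Set (EuclideanSpace ℝ (Fin N)))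
    (v : EuclideanSpace ℝ (Fin N) → ℝ) (x : EuclideanSpace ℝ (Fin N)) : ℝ :=
  if x ∈ Ω then pMean p (volume.restrict (Metric.ball x (rEps ε Ω x))) v else v x

/-- The class `S_g` of variational `p`-subsolutions of the Dirichlet-type problem:
continuous on `closure Ω`, `v ≤ μ_p^ε[v]` in `Ω`, and `v ≤ g` on `Γ = ∂Ω`. -/
def SgLower {N : ℕ} (p : ℝ≥0∞) (ε : ℝ) (Ω : Set (EuclideanSpace ℝ (Fin N)))
    (g : EuclideanSpace ℝ (Fin N) → ℝ) : Set (EuclideanSpace ℝ (Fin N) → ℝ) :=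
  {v | ContinuousOn v (closure Ω) ∧ (∀ x ∈ Ω, v x ≤ muEps p ε Ω v x) ∧
    ∀ x ∈ frontier Ω, v x ≤ g x}

/-- The class `S^g` of variational `p`-supersolutions of the Dirichlet-type problem:
continuous on `closure Ω`, `v ≥ μ_p^ε[v]` in `Ω`, and `v ≥ g` on `Γ = ∂Ω`. -/
def SgUpper {N : ℕ} (p : ℝ≥0∞) (ε : ℝ) (Ω : Set (EuclideanSpace ℝ (Fin N)))
    (g : EuclideanSpace ℝ (Fin N) → ℝ) : Set (EuclideanSpace ℝ (Fin N) → ℝ) :=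
  {v | ContinuousOn v (closure Ω) ∧ (∀ x ∈ Ω, muEps p ε Ω v x ≤ v x) ∧
    ∀ x ∈ frontier Ω, g x ≤ v x}

/-- The lower Perron solution `u̲^ε(x) = sup_{v ∈ S_g} v(x)`. -/
def lowerPerron {N : ℕ} (p : ℝ≥0∞) (ε : ℝ) (Ω : Set (EuclideanSpace ℝ (Fin N)))
    (g : EuclideanSpace ℝ (Fin N) → ℝ) (x : EuclideanSpace ℝ (Fin N)) : ℝ :=
  sSup ((fun v => v x) '' SgLower p ε Ω g)

/-- The upper Perron solution `u̅^ε(x) = inf_{w ∈ S^g} w(x)`. -/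
def upperPerron {N : ℕ} (p : ℝ≥0∞) (ε : ℝ) (Ω : Set (EuclideanSpace ℝ (Fin N)))
    (g : EuclideanSpace ℝ (Fin N) → ℝ) (x : EuclideanSpace ℝ (Fin N)) : ℝ :=
  sInf ((fun v => v x) '' SgUpper p ε Ω g)

/-- A barrier at `x₀ ∈ Γ` for the Dirichlet-type problem: a continuous function on
`closure Ω`, variationally `p`-superharmonious in `Ω`, positive on `closure Ω ∖ {x₀}`,
vanishing at `x₀`. A boundary point admitting a barrier is called regular. -/
def IsBarrier {N : ℕ} (p : ℝ≥0∞) (ε : ℝ) (Ω : Set (EuclideanSpace ℝ (Fin N)))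
    (x₀ : EuclideanSpace ℝ (Fin N)) (w : EuclideanSpace ℝ (Fin N) → ℝ) : Prop :=
  ContinuousOn w (closure Ω) ∧ (∀ x ∈ Ω, muEps p ε Ω w x ≤ w x) ∧
    (∀ x ∈ closure Ω, x ≠ x₀ → 0 < w x) ∧ w x₀ = 0

/-- A solution of the Dirichlet-type problem `u = μ_p^ε[u]` in `Ω`, `u = g` on `Γ`,
of class `C(closure Ω)`. -/
def IsDirichletSolution {N : ℕ} (p : ℝ≥0∞) (ε : ℝ) (Ω : Set (EuclideanSpace ℝ (Fin N)))
    (g u : EuclideanSpace ℝ (Fin N) → ℝ) : Prop :=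
  ContinuousOn u (closure Ω) ∧ (∀ x ∈ Ω, u x = muEps p ε Ω u x) ∧
    ∀ x ∈ frontier Ω, u x = g x

/-- The odd power `t ↦ sign t * |t| ^ q`. -/
def oddPow (q t : ℝ) : ℝ := (max t 0) ^ q - (max (-t) 0) ^ q

lemma oddPow_neg (q t : ℝ) : oddPow q (-t) = -oddPow q t := by
  simp [oddPow]

lemma oddPow_of_nonneg {q t : ℝ} (hq : 0 < q) (ht : 0 ≤ t) : oddPow q t = t ^ q := by
  simp [oddPow, ht, Real.zero_rpow hq.ne']

lemma continuous_oddPow {q : ℝ} (hq : 0 < q) : Continuous (oddPow q) := by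
  unfold oddPow
  exact ((continuous_id.max continuous_const).rpow_const fun _ => Or.inr hq.le).sub
    ((continuous_neg.max continuous_const).rpow_const fun _ => Or.inr hq.le)

lemma oddPow_strictMono {q : ℝ} (hq : 0 < q) : StrictMono (oddPow q) := by
  intro a b hab
  rcases lt_or_ge a 0 with ha | ha
  · have h1 : (max (-b) 0) ^ q < (max (-a) 0) ^ q :=
      Real.rpow_lt_rpow (le_max_right _ _) (by rw [max_eq_left (by linarith : 0 ≤ -a)]; grind) hq
    have h2 : (max a 0) ^ q ≤ (max b 0) ^ q :=
      Real.rpow_le_rpow (le_max_right _ _) (max_le_max_right _ hab.le) hq.le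
    unfold oddPow
    linarith
  · rw [oddPow_of_nonneg hq ha, oddPow_of_nonneg hq (ha.trans hab.le)]
    exact Real.rpow_lt_rpow ha hab hq

lemma oddPow_mul {q c : ℝ} (hc : 0 ≤ c) (t : ℝ) : oddPow q (c * t) = c ^ q * oddPow q t := by
  have h (s : ℝ) : max (c * s) 0 = c * max s 0 := by
    rw [← mul_zero c, ← mul_max_of_nonneg _ _ hc, mul_zero]
  rw [oddPow, oddPow, h, ← mul_neg, h, Real.mul_rpow hc (le_max_right _ _),
    Real.mul_rpow hc (le_max_right _ _)]
  ring

lemma oddPow_zero (q : ℝ) : oddPow q 0 = 0 := by simp [oddPow]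

lemma oddPow_nonneg_iff {q t : ℝ} (hq : 0 < q) : 0 ≤ oddPow q t ↔ 0 ≤ t := by
  simpa [oddPow_zero] using (oddPow_strictMono hq).le_iff_le (a := 0) (b := t)

lemma oddPow_nonpos_iff {q t : ℝ} (hq : 0 < q) : oddPow q t ≤ 0 ↔ t ≤ 0 := by
  simpa [oddPow_zero] using (oddPow_strictMono hq).le_iff_le (a := t) (b := 0)

lemma abs_rpow_subgradient_of_pos {q s t : ℝ} (hq : 0 < q) (hs : 0 < s) (hst : t ≠ s) :
    |s| ^ (q + 1) + (q + 1) * oddPow q s * (t - s) < |t| ^ (q + 1) := by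
  have key : ∀ t : ℝ, 0 ≤ t → t ≠ s → s ^ (q + 1) + (q + 1) * s ^ q * (t - s) < t ^ (q + 1) := by
    intro t ht hst
    have hb := one_add_mul_self_lt_rpow_one_add (s := (t - s) / s)
      (by rw [le_div_iff₀ hs]; linarith) (div_ne_zero (sub_ne_zero.2 hst) hs.ne')
      (p := q + 1) (by linarith)
    have e : 1 + (t - s) / s = t / s := by field_simp; ring
    rw [e, Real.div_rpow ht hs.le, lt_div_iff₀ (by positivity)] at hb
    have hpow : s ^ (q + 1) = s ^ q * s := by rw [Real.rpow_add_one hs.ne']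
    calc s ^ (q + 1) + (q + 1) * s ^ q * (t - s)
        = (1 + (q + 1) * ((t - s) / s)) * s ^ (q + 1) := by rw [hpow]; field_simp
      _ < _ := hb
  rw [abs_of_pos hs, oddPow_of_nonneg hq hs.le]
  have hsq : 0 < s ^ q := by positivity
  rcases eq_or_ne |t| s with h | h
  · have : t = -s := by grind
    rw [h]
    have : (q + 1) * s ^ q * (t - s) < 0 := mul_neg_of_pos_of_neg (by positivity) (by linarith)
    linarith
  · have h1 := key |t| (abs_nonneg _) h
    have h2 : (q + 1) * s ^ q * (t - s) ≤ (q + 1) * s ^ q * (|t| - s) :=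
      mul_le_mul_of_nonneg_left (by linarith [le_abs_self t]) (by positivity)
    linarith

lemma abs_rpow_subgradient {q s t : ℝ} (hq : 0 < q) (hst : t ≠ s) :
    |s| ^ (q + 1) + (q + 1) * oddPow q s * (t - s) < |t| ^ (q + 1) := by
  rcases lt_trichotomy s 0 with hs | rfl | hs
  · have := abs_rpow_subgradient_of_pos (t := -t) hq (neg_pos.2 hs) (by simpa using hst)
    rw [oddPow_neg, abs_neg, abs_neg] at this
    linarith
  · have : 0 < |t| ^ (q + 1) := Real.rpow_pos_of_pos (abs_pos.2 hst) _
    simpa [oddPow_zero, Real.zero_rpow (by linarith : q + 1 ≠ 0)] using this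
  · exact abs_rpow_subgradient_of_pos hq hs hst

/-- Lebesgue measure on the open unit ball. -/
def unitBallMeasure (N : ℕ) : Measure (EuclideanSpace ℝ (Fin N)) :=
  volume.restrict (ball 0 1)

instance (N : ℕ) : IsFiniteMeasure (unitBallMeasure N) :=
  ⟨by simpa [unitBallMeasure] using measure_ball_lt_top⟩

lemma unitBallMeasure_ne_zero (N : ℕ) : unitBallMeasure N ≠ 0 := by
  rw [unitBallMeasure, Ne, Measure.restrict_eq_zero]
  exact (measure_ball_pos _ _ one_pos).ne'

/-- A characterization of the inequality `ν_p[f] ≤ m` for the `p`-mean on the unit ball which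
also makes sense for semicontinuous `f`. -/
def MeanLE {N : ℕ} (p : ℝ≥0∞) (f : EuclideanSpace ℝ (Fin N) → ℝ) (m : ℝ) : Prop :=
  (p = ⊤ → ∀ y ∈ closedBall 0 1, ∃ z ∈ closedBall 0 1, f y + f z ≤ 2 * m) ∧
  (p ≠ ⊤ → Integrable (fun h => oddPow (p.toReal - 1) (f h - m)) (unitBallMeasure N) ∧
    ∫ h, oddPow (p.toReal - 1) (f h - m) ∂unitBallMeasure N ≤ 0)

lemma ae_mem_unitBall (N : ℕ) : ∀ᵐ h ∂unitBallMeasure N, h ∈ ball 0 1 :=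
  ae_restrict_mem measurableSet_ball

lemma toReal_sub_one_pos {p : ℝ≥0∞} (hp : 1 < p) (hpt : p ≠ ⊤) : 0 < p.toReal - 1 := by
  have : (1 : ℝ≥0∞).toReal < p.toReal := (ENNReal.toReal_lt_toReal (by simp) hpt).2 hp
  simpa using this

lemma integral_lt_integral_of_forall_lt {α : Type*} [MeasurableSpace α] {μ : Measure α}
    (hμ : μ ≠ 0) {f g : α → ℝ} (hf : Integrable f μ) (hg : Integrable g μ)
    (hfg : ∀ x, f x < g x) : ∫ x, f x ∂μ < ∫ x, g x ∂μ := by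
  rw [← sub_pos, ← integral_sub hg hf]
  refine (integral_pos_iff_support_of_nonneg (fun x => (sub_pos.2 (hfg x)).le) (hg.sub hf)).2 ?_
  have : Function.support (fun x => g x - f x) = Set.univ :=
    Set.eq_univ_of_forall fun x => (sub_pos.2 (hfg x)).ne'
  rw [this]
  exact Measure.measure_univ_pos.2 hμ

section FixedFunction

variable {N : ℕ} {p : ℝ≥0∞} {f : EuclideanSpace ℝ (Fin N) → ℝ}

lemma integrable_comp_of_continuousOn (hf : ContinuousOn f (closedBall 0 1)) {g : ℝ → ℝ}
    (hg : Continuous g) : Integrable (fun h => g (f h)) (unitBallMeasure N) := by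
  have : IntegrableOn (fun h => g (f h)) (closedBall (0 : EuclideanSpace ℝ (Fin N)) 1) volume :=
    (hg.comp_continuousOn hf).integrableOn_compact (isCompact_closedBall _ _)
  exact this.mono_set ball_subset_closedBall

lemma exists_bound_of_continuousOn (hf : ContinuousOn f (closedBall 0 1)) :
    ∃ C, ∀ h ∈ closedBall 0 1, |f h| ≤ C :=
  (isCompact_closedBall _ _).exists_bound_of_continuousOn hf

lemma eLpNorm_lt_of_integral_oddPow_eq_zero (hp : 1 < p) (hpt : p ≠ ⊤)
    (hf : ContinuousOn f (closedBall 0 1)) {m ν : ℝ} (hν : ν ≠ m)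
    (hm : ∫ h, oddPow (p.toReal - 1) (f h - m) ∂unitBallMeasure N = 0) :
    eLpNorm (fun x => f x - m) p (unitBallMeasure N) <
      eLpNorm (fun x => f x - ν) p (unitBallMeasure N) := by
  have hq := toReal_sub_one_pos hp hpt
  set q := p.toReal - 1 with hqdef
  have hpq : p.toReal = q + 1 := by simp [hqdef]
  obtain ⟨C, hC⟩ := exists_bound_of_continuousOn hf
  have hmem (c : ℝ) : MemLp (fun x => f x - c) p (unitBallMeasure N) := by
    refine MemLp.of_bound (C := C + |c|)
      (integrable_comp_of_continuousOn hf (g := fun t => t - c) (by fun_prop)).1 ?_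
    filter_upwards [ae_mem_unitBall N] with h hh
    exact (abs_sub _ _).trans (by linarith [hC h (ball_subset_closedBall hh)])
  have hint (c : ℝ) : Integrable (fun x => |f x - c| ^ (q + 1)) (unitBallMeasure N) :=
    integrable_comp_of_continuousOn hf (g := fun t => |t - c| ^ (q + 1))
      (((continuous_id.sub continuous_const).abs).rpow_const fun _ => Or.inr (by linarith))
  have hint2 : Integrable (fun h => oddPow q (f h - m)) (unitBallMeasure N) :=
    integrable_comp_of_continuousOn hf (g := fun t => oddPow q (t - m))
      ((continuous_oddPow hq).comp (by fun_prop))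
  rw [(hmem m).eLpNorm_eq_integral_rpow_norm (by positivity) hpt,
    (hmem ν).eLpNorm_eq_integral_rpow_norm (by positivity) hpt]
  simp only [Real.norm_eq_abs, hpq]
  have key : ∫ x, |f x - m| ^ (q + 1) ∂unitBallMeasure N <
      ∫ x, |f x - ν| ^ (q + 1) ∂unitBallMeasure N := by
    have h1 : ∫ x, (|f x - m| ^ (q + 1) + (q + 1) * oddPow q (f x - m) * (m - ν))
        ∂unitBallMeasure N = ∫ x, |f x - m| ^ (q + 1) ∂unitBallMeasure N := by
      rw [integral_add (hint m) ((hint2.const_mul _).mul_const _), integral_mul_const,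
        integral_const_mul, hm]
      ring
    rw [← h1]
    refine integral_lt_integral_of_forall_lt (unitBallMeasure_ne_zero N)
      ((hint m).add ((hint2.const_mul _).mul_const _)) (hint ν) fun x => ?_
    have := abs_rpow_subgradient (s := f x - m) (t := f x - ν) hq (by grind)
    simpa using this
  have h0 : 0 ≤ ∫ x, |f x - m| ^ (q + 1) ∂unitBallMeasure N :=
    integral_nonneg fun x => by positivity
  rw [ENNReal.ofReal_lt_ofReal_iff (Real.rpow_pos_of_pos (h0.trans_lt key) _)]
  exact Real.rpow_lt_rpow h0 key (by positivity)

lemma exists_integral_oddPow_eq_zero {q : ℝ} (hq : 0 < q)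
    (hf : ContinuousOn f (closedBall 0 1)) :
    ∃ m, ∫ h, oddPow q (f h - m) ∂unitBallMeasure N = 0 := by
  obtain ⟨C, hC⟩ := exists_bound_of_continuousOn hf
  have hC0 : 0 ≤ C := (abs_nonneg _).trans (hC 0 (by simp))
  have hcont : ContinuousOn (fun m => ∫ h, oddPow q (f h - m) ∂unitBallMeasure N)
      (Set.Icc (-C) C) := by
    refine continuousOn_of_dominated (bound := fun _ => oddPow q (2 * C)) ?_ ?_
      (integrable_const _) ?_
    · exact fun m _ => (integrable_comp_of_continuousOn hf (g := fun t => oddPow q (t - m))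
        ((continuous_oddPow hq).comp (by fun_prop))).1
    · intro m hm
      filter_upwards [ae_mem_unitBall N] with h hh
      have := abs_le.1 (hC h (ball_subset_closedBall hh))
      rw [Real.norm_eq_abs, abs_le, ← oddPow_neg]
      exact ⟨(oddPow_strictMono hq).monotone (by linarith [hm.1, hm.2]),
        (oddPow_strictMono hq).monotone (by linarith [hm.1, hm.2])⟩
    · exact Eventually.of_forall fun h =>
        ((continuous_oddPow hq).comp (by fun_prop : Continuous fun m => f h - m)).continuousOn
  have h1 : ∫ h, oddPow q (f h - C) ∂unitBallMeasure N ≤ 0 := by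
    refine integral_nonpos_of_ae ?_
    filter_upwards [ae_mem_unitBall N] with h hh
    have := abs_le.1 (hC h (ball_subset_closedBall hh))
    exact (oddPow_nonpos_iff hq).2 (by linarith)
  have h2 : 0 ≤ ∫ h, oddPow q (f h - -C) ∂unitBallMeasure N := by
    refine integral_nonneg_of_ae ?_
    filter_upwards [ae_mem_unitBall N] with h hh
    have := abs_le.1 (hC h (ball_subset_closedBall hh))
    exact (oddPow_nonneg_iff hq).2 (by linarith)
  obtain ⟨m, -, hm⟩ := intermediate_value_Icc' (by linarith : -C ≤ C) hcont ⟨h1, h2⟩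
  exact ⟨m, hm⟩

lemma integral_oddPow_strictAnti {q : ℝ} (hq : 0 < q)
    (hf : ContinuousOn f (closedBall 0 1)) :
    StrictAnti fun m => ∫ h, oddPow q (f h - m) ∂unitBallMeasure N := by
  intro a b hab
  have hint (c : ℝ) : Integrable (fun h => oddPow q (f h - c)) (unitBallMeasure N) :=
    integrable_comp_of_continuousOn hf (g := fun t => oddPow q (t - c))
      ((continuous_oddPow hq).comp (by fun_prop))
  exact integral_lt_integral_of_forall_lt (unitBallMeasure_ne_zero N) (hint b) (hint a)
    fun x => oddPow_strictMono hq (by linarith)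

lemma pMean_eq_of_unique {μ : Measure (EuclideanSpace ℝ (Fin N))} {m : ℝ}
    (hm : IsPMean p μ f m) (h : ∀ m', IsPMean p μ f m' → m' = m) : pMean p μ f = m :=
  h _ (Classical.epsilon_spec ⟨m, hm⟩)

lemma isPMean_iff_integral_oddPow (hp : 1 < p) (hpt : p ≠ ⊤)
    (hf : ContinuousOn f (closedBall 0 1)) {m : ℝ} :
    IsPMean p (unitBallMeasure N) f m ↔
      ∫ h, oddPow (p.toReal - 1) (f h - m) ∂unitBallMeasure N = 0 := by
  constructor
  · intro h
    obtain ⟨m₀, hm₀⟩ := exists_integral_oddPow_eq_zero (toReal_sub_one_pos hp hpt) hf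
    rcases eq_or_ne m m₀ with rfl | hne
    · exact hm₀
    · exact absurd (h m₀) (eLpNorm_lt_of_integral_oddPow_eq_zero hp hpt hf hne hm₀).not_ge
  · intro h ν
    rcases eq_or_ne ν m with rfl | hne
    · exact le_rfl
    · exact (eLpNorm_lt_of_integral_oddPow_eq_zero hp hpt hf hne h).le

lemma integral_oddPow_pMean (hp : 1 < p) (hpt : p ≠ ⊤) (hf : ContinuousOn f (closedBall 0 1)) :
    ∫ h, oddPow (p.toReal - 1) (f h - pMean p (unitBallMeasure N) f) ∂unitBallMeasure N = 0 := by
  obtain ⟨m₀, hm₀⟩ := exists_integral_oddPow_eq_zero (toReal_sub_one_pos hp hpt) hf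
  exact (isPMean_iff_integral_oddPow hp hpt hf).1
    (Classical.epsilon_spec ⟨m₀, (isPMean_iff_integral_oddPow hp hpt hf).2 hm₀⟩)

lemma eLpNorm_top_sub_const (hf : ContinuousOn f (closedBall 0 1))
    {a b : EuclideanSpace ℝ (Fin N)} (ha : a ∈ closedBall 0 1) (hb : b ∈ closedBall 0 1)
    (hmax : IsMaxOn f (closedBall 0 1) a) (hmin : IsMinOn f (closedBall 0 1) b) (c : ℝ) :
    eLpNorm (fun x => f x - c) ⊤ (unitBallMeasure N) =
      ENNReal.ofReal (max (f a - c) (c - f b)) := by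
  rw [eLpNorm_exponent_top]
  apply le_antisymm
  · refine eLpNormEssSup_le_of_ae_bound ?_
    filter_upwards [ae_mem_unitBall N] with h hh
    have h1 : f h ≤ f a := hmax (ball_subset_closedBall hh)
    have h2 : f b ≤ f h := hmin (ball_subset_closedBall hh)
    rw [Real.norm_eq_abs, abs_le]
    exact ⟨by linarith [le_max_right (f a - c) (c - f b)],
      by linarith [le_max_left (f a - c) (c - f b)]⟩
  · set K := eLpNormEssSup (fun x => f x - c) (unitBallMeasure N)
    have hae : ∀ᵐ h ∂unitBallMeasure N, ‖f h - c‖ₑ ≤ K := ae_le_eLpNormEssSup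
    have hball : ∀ h ∈ ball (0 : EuclideanSpace ℝ (Fin N)) 1, ‖f h - c‖ₑ ≤ K := by
      by_contra! hcon
      obtain ⟨h, hh, hlt⟩ := hcon
      have hcont : ContinuousAt (fun x => ‖f x - c‖ₑ) h :=
        ((hf.continuousAt (mem_of_superset (isOpen_ball.mem_nhds hh)
          ball_subset_closedBall)).sub continuousAt_const).enorm
      have hev : ∀ᶠ x in 𝓝 h, K < ‖f x - c‖ₑ ∧ x ∈ ball 0 1 :=
        (hcont.eventually (lt_mem_nhds hlt)).and (isOpen_ball.mem_nhds hh)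
      rw [unitBallMeasure, ae_restrict_iff' measurableSet_ball] at hae
      exact absurd (measure_mono_null (fun x (hx : K < ‖f x - c‖ₑ ∧ x ∈ ball 0 1) =>
        fun hx' => (hx' hx.2).not_gt hx.1) hae) (Measure.measure_pos_of_mem_nhds volume hev).ne'
    have hclosed : ∀ h ∈ closedBall (0 : EuclideanSpace ℝ (Fin N)) 1, ‖f h - c‖ₑ ≤ K := by
      rw [← closure_ball _ one_ne_zero] at hf ⊢
      intro h hh
      exact le_on_closure (f := fun h => ‖f h - c‖ₑ) (g := fun _ => K) hball
        (hf.sub continuousOn_const).enorm continuousOn_const hh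
    have hK (h) (hh : h ∈ closedBall 0 1) : ENNReal.ofReal |f h - c| ≤ K := by
      rw [← Real.enorm_eq_ofReal_abs]
      exact hclosed h hh
    rcases max_cases (f a - c) (c - f b) with ⟨h, -⟩ | ⟨h, -⟩ <;> rw [h]
    · exact (ENNReal.ofReal_le_ofReal (le_abs_self _)).trans (hK a ha)
    · refine (ENNReal.ofReal_le_ofReal ?_).trans (hK b hb)
      rw [abs_sub_comm]
      exact le_abs_self _

lemma pMean_top (hf : ContinuousOn f (closedBall 0 1))
    {a b : EuclideanSpace ℝ (Fin N)} (ha : a ∈ closedBall 0 1) (hb : b ∈ closedBall 0 1)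
    (hmax : IsMaxOn f (closedBall 0 1) a) (hmin : IsMinOn f (closedBall 0 1) b) :
    pMean ⊤ (unitBallMeasure N) f = (f a + f b) / 2 := by
  have hab : f b ≤ f a := hmax hb
  have h := eLpNorm_top_sub_const hf ha hb hmax hmin
  have h0 (c : ℝ) : 0 ≤ max (f a - c) (c - f b) := by
    rcases le_total (f a) c with hc | hc
    · exact le_max_of_le_right (by linarith)
    · exact le_max_of_le_left (by linarith)
  apply pMean_eq_of_unique
  · intro ν
    rw [h, h]
    refine ENNReal.ofReal_le_ofReal (max_le ?_ ?_) <;>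
    · linarith [le_max_left (f a - ν) (ν - f b), le_max_right (f a - ν) (ν - f b)]
  · intro m hm
    have := hm ((f a + f b) / 2)
    rw [h, h, ENNReal.ofReal_le_ofReal_iff (h0 _)] at this
    have e : max (f a - (f a + f b) / 2) ((f a + f b) / 2 - f b) = (f a - f b) / 2 := by
      rw [max_eq_left] <;> linarith
    rw [e] at this
    linarith [le_max_left (f a - m) (m - f b), le_max_right (f a - m) (m - f b)]

lemma exists_max_min (hf : ContinuousOn f (closedBall 0 1)) :
    ∃ a ∈ closedBall 0 1, ∃ b ∈ closedBall 0 1,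
      IsMaxOn f (closedBall 0 1) a ∧ IsMinOn f (closedBall 0 1) b := by
  have hne : (closedBall (0 : EuclideanSpace ℝ (Fin N)) 1).Nonempty := ⟨0, by simp⟩
  obtain ⟨a, ha, hmax⟩ := (isCompact_closedBall _ _).exists_isMaxOn hne hf
  obtain ⟨b, hb, hmin⟩ := (isCompact_closedBall _ _).exists_isMinOn hne hf
  exact ⟨a, ha, b, hb, hmax, hmin⟩

lemma pMean_le_iff (hp : 1 < p) (hf : ContinuousOn f (closedBall 0 1)) {m : ℝ} :
    pMean p (unitBallMeasure N) f ≤ m ↔ MeanLE p f m := by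
  rcases eq_or_ne p ⊤ with rfl | hpt
  · obtain ⟨a, ha, b, hb, hmax, hmin⟩ := exists_max_min hf
    rw [pMean_top hf ha hb hmax hmin]
    simp only [MeanLE, forall_const, ne_eq, not_true_eq_false, false_imp_iff, and_true]
    constructor
    · intro h y hy
      have h1 : f y ≤ f a := hmax hy
      exact ⟨b, hb, by linarith⟩
    · intro h
      obtain ⟨z, hz, hle⟩ := h a ha
      have h1 : f b ≤ f z := hmin hz
      linarith
  · have hq := toReal_sub_one_pos hp hpt
    simp only [MeanLE, hpt, false_imp_iff, true_and, ne_eq, not_false_eq_true, true_imp_iff]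
    rw [← integral_oddPow_pMean hp hpt hf, (integral_oddPow_strictAnti hq hf).le_iff_ge]
    exact (and_iff_right (integrable_comp_of_continuousOn hf
      (g := fun t => oddPow (p.toReal - 1) (t - m))
      ((continuous_oddPow hq).comp (by fun_prop)))).symm

lemma pMean_neg (hp : 1 < p) (hf : ContinuousOn f (closedBall 0 1)) :
    pMean p (unitBallMeasure N) (-f) = -pMean p (unitBallMeasure N) f := by
  rcases eq_or_ne p ⊤ with rfl | hpt
  · obtain ⟨a, ha, b, hb, hmax, hmin⟩ := exists_max_min hf
    rw [pMean_top hf ha hb hmax hmin, pMean_top hf.neg hb ha hmin.neg hmax.neg]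
    simp only [Pi.neg_apply]
    ring
  · have hq := toReal_sub_one_pos hp hpt
    apply (integral_oddPow_strictAnti hq hf.neg).injective
    simp only []
    rw [integral_oddPow_pMean hp hpt hf.neg]
    have : ∀ h, oddPow (p.toReal - 1) ((-f) h - -pMean p (unitBallMeasure N) f) =
        -oddPow (p.toReal - 1) (f h - pMean p (unitBallMeasure N) f) := by
      intro h
      rw [← oddPow_neg]
      congr 1
      simp
      ring
    simp only [this, integral_neg, integral_oddPow_pMean hp hpt hf, neg_zero]

lemma le_pMean_iff (hp : 1 < p) (hf : ContinuousOn f (closedBall 0 1)) {m : ℝ} :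
    m ≤ pMean p (unitBallMeasure N) f ↔ MeanLE p (-f) (-m) := by
  rw [← pMean_le_iff hp hf.neg, pMean_neg hp hf, neg_le_neg_iff]

end FixedFunction

section MeanProperties

variable {N : ℕ} {p : ℝ≥0∞} {f g : EuclideanSpace ℝ (Fin N) → ℝ}

lemma MeanLE.of_le (hp : 1 < p) (hf : ContinuousOn f (closedBall 0 1)) {m : ℝ}
    (hg : MeanLE p g m) (hfg : ∀ h ∈ closedBall 0 1, f h ≤ g h) : MeanLE p f m := by
  refine ⟨fun hpt y hy => ?_, fun hpt => ?_⟩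
  · obtain ⟨z, hz, hyz⟩ := hg.1 hpt y hy
    exact ⟨z, hz, by linarith [hfg y hy, hfg z hz]⟩
  · have hq := toReal_sub_one_pos hp hpt
    have hint := integrable_comp_of_continuousOn hf
      (g := fun t => oddPow (p.toReal - 1) (t - m)) ((continuous_oddPow hq).comp (by fun_prop))
    refine ⟨hint, (integral_mono_ae hint (hg.2 hpt).1 ?_).trans (hg.2 hpt).2⟩
    filter_upwards [ae_mem_unitBall N] with h hh
    exact (oddPow_strictMono hq).monotone
      (sub_le_sub_right (hfg h (ball_subset_closedBall hh)) _)

lemma MeanLE.affine {m : ℝ} (hf : MeanLE p f m) (a : ℝ) {c : ℝ} (hc : 0 ≤ c) :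
    MeanLE p (fun h => a + c * f h) (a + c * m) := by
  refine ⟨fun hpt y hy => ?_, fun hpt => ?_⟩
  · obtain ⟨z, hz, hyz⟩ := hf.1 hpt y hy
    exact ⟨z, hz, by linarith [mul_le_mul_of_nonneg_left hyz hc]⟩
  · have e (h : EuclideanSpace ℝ (Fin N)) : oddPow (p.toReal - 1) (a + c * f h - (a + c * m)) =
        c ^ (p.toReal - 1) * oddPow (p.toReal - 1) (f h - m) := by
      rw [← oddPow_mul hc]
      ring_nf
    simp only [e, integral_const_mul]
    exact ⟨(hf.2 hpt).1.const_mul _,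
      mul_nonpos_of_nonneg_of_nonpos (by positivity) (hf.2 hpt).2⟩

lemma pMean_mono (hp : 1 < p) (hf : ContinuousOn f (closedBall 0 1))
    (hg : ContinuousOn g (closedBall 0 1)) (hfg : ∀ h ∈ closedBall 0 1, f h ≤ g h) :
    pMean p (unitBallMeasure N) f ≤ pMean p (unitBallMeasure N) g :=
  (pMean_le_iff hp hf).2 (((pMean_le_iff hp hg).1 le_rfl).of_le hp hf hfg)

lemma continuousOn_const_add {s : Set (EuclideanSpace ℝ (Fin N))} (hf : ContinuousOn f s) (a : ℝ) :
    ContinuousOn (fun h => a + f h) s :=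
  continuousOn_const.add hf

lemma pMean_add_const_le (hp : 1 < p) (hf : ContinuousOn f (closedBall 0 1)) (a : ℝ) :
    pMean p (unitBallMeasure N) (fun h => a + f h) ≤ a + pMean p (unitBallMeasure N) f := by
  rw [pMean_le_iff hp (continuousOn_const_add hf a)]
  simpa using ((pMean_le_iff hp hf).1 le_rfl).affine a zero_le_one

lemma abs_pMean_sub_pMean_le (hp : 1 < p) (hf : ContinuousOn f (closedBall 0 1))
    (hg : ContinuousOn g (closedBall 0 1)) {δ : ℝ} (hfg : ∀ h ∈ closedBall 0 1, |f h - g h| ≤ δ) :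
    |pMean p (unitBallMeasure N) f - pMean p (unitBallMeasure N) g| ≤ δ := by
  have h1 := pMean_mono hp hf (continuousOn_const_add hg δ)
    fun h hh => by linarith [(abs_le.1 (hfg h hh)).2]
  have h2 := pMean_mono hp hg (continuousOn_const_add hf δ)
    fun h hh => by linarith [(abs_le.1 (hfg h hh)).1]
  have h3 := pMean_add_const_le hp hf δ
  have h4 := pMean_add_const_le hp hg δ
  rw [abs_le]
  exact ⟨by linarith, by linarith⟩

lemma pMean_const (hp : 1 < p) (a : ℝ) : pMean p (unitBallMeasure N) (fun _ => a) = a := by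
  have h (b : ℝ) : MeanLE p (fun _ : EuclideanSpace ℝ (Fin N) => b) b :=
    ⟨fun _ y hy => ⟨y, hy, by linarith⟩, fun _ => by simp [oddPow_zero]⟩
  exact le_antisymm ((pMean_le_iff hp continuousOn_const).2 (h a))
    ((le_pMean_iff hp continuousOn_const).2 (h (-a)))

lemma volume_restrict_ball_eq (x : EuclideanSpace ℝ (Fin N)) {r : ℝ} (hr : 0 < r) :
    (volume : Measure (EuclideanSpace ℝ (Fin N))).restrict (ball x r) =
      ENNReal.ofReal (r ^ N) • Measure.map (fun h => x + r • h) (unitBallMeasure N) := by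
  have he : MeasurableEmbedding fun h : EuclideanSpace ℝ (Fin N) => x + r • h :=
    ((Homeomorph.smulOfNeZero r hr.ne').trans (Homeomorph.addLeft x)).measurableEmbedding
  have hpre : (fun h : EuclideanSpace ℝ (Fin N) => x + r • h) ⁻¹' ball x r = ball 0 1 := by
    ext h
    simp [norm_smul, abs_of_pos hr, hr]
  have hmap : Measure.map (fun h : EuclideanSpace ℝ (Fin N) => x + r • h) volume =
      ENNReal.ofReal (r ^ N)⁻¹ • volume := by
    have : (fun h : EuclideanSpace ℝ (Fin N) => x + r • h) = (x + ·) ∘ (r • ·) := rfl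
    rw [this, ← Measure.map_map (by fun_prop) (by fun_prop), Measure.map_addHaar_smul _ hr.ne',
      Measure.map_smul, map_add_left_eq_self, finrank_euclideanSpace_fin,
      abs_of_pos (by positivity)]
  rw [unitBallMeasure, ← hpre, ← he.restrict_map, hmap, Measure.restrict_smul, smul_smul,
    ← ENNReal.ofReal_mul (by positivity), mul_inv_cancel₀ (by positivity), ENNReal.ofReal_one,
    one_smul]

lemma pMean_ball_eq (v : EuclideanSpace ℝ (Fin N) → ℝ) (x : EuclideanSpace ℝ (Fin N)) {r : ℝ}
    (hr : 0 < r) : pMean p (volume.restrict (ball x r)) v =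
      pMean p (unitBallMeasure N) fun h => v (x + r • h) := by
  have he : MeasurableEmbedding fun h : EuclideanSpace ℝ (Fin N) => x + r • h :=
    ((Homeomorph.smulOfNeZero r hr.ne').trans (Homeomorph.addLeft x)).measurableEmbedding
  have hc : ENNReal.ofReal (r ^ N) ≠ 0 := by simpa using pow_pos hr N
  unfold pMean
  congr 1
  funext m
  refine propext (forall_congr' fun ν => ?_)
  have hc1 : ENNReal.ofReal (r ^ N) ^ (1 / p).toReal ≠ 0 := by simp [hc]
  have hc2 : ENNReal.ofReal (r ^ N) ^ (1 / p).toReal ≠ ⊤ :=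
    ENNReal.rpow_ne_top_of_nonneg (by positivity) ENNReal.ofReal_ne_top
  rw [volume_restrict_ball_eq x hr, eLpNorm_smul_measure_of_ne_zero hc,
    eLpNorm_smul_measure_of_ne_zero hc, he.eLpNorm_map_measure, he.eLpNorm_map_measure,
    smul_eq_mul, smul_eq_mul, ENNReal.mul_le_mul_iff_right hc1 hc2]
  rfl

end MeanProperties

/-- A bounded open set with nonempty boundary. -/
structure IsBoundedDomain {N : ℕ} (Ω : Set (EuclideanSpace ℝ (Fin N))) : Prop where
  isOpen : IsOpen Ω
  isBounded : Bornology.IsBounded Ω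
  frontier_nonempty : (frontier Ω).Nonempty

/-- The parametrization of `B_{r_ε(x)}(x)` by the unit ball. -/
def ballMap {N : ℕ} (ε : ℝ) (Ω : Set (EuclideanSpace ℝ (Fin N)))
    (x h : EuclideanSpace ℝ (Fin N)) : EuclideanSpace ℝ (Fin N) :=
  x + rEps ε Ω x • h

section Domain

variable {N : ℕ} {p : ℝ≥0∞} {ε : ℝ} {Ω : Set (EuclideanSpace ℝ (Fin N))}
  {u v w : EuclideanSpace ℝ (Fin N) → ℝ}

namespace IsBoundedDomain

lemma isCompact_closure (hΩ : IsBoundedDomain Ω) : IsCompact (closure Ω) :=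
  hΩ.isBounded.isCompact_closure

lemma isCompact_frontier (hΩ : IsBoundedDomain Ω) : IsCompact (frontier Ω) :=
  hΩ.isCompact_closure.of_isClosed_subset isClosed_frontier frontier_subset_closure

lemma notMem_frontier (hΩ : IsBoundedDomain Ω) {x : EuclideanSpace ℝ (Fin N)} (hx : x ∈ Ω) :
    x ∉ frontier Ω := fun h => by
  rw [hΩ.isOpen.frontier_eq] at h
  exact h.2 hx

lemma notMem_of_mem_frontier (hΩ : IsBoundedDomain Ω) {x : EuclideanSpace ℝ (Fin N)}
    (hx : x ∈ frontier Ω) : x ∉ Ω := fun h => hΩ.notMem_frontier h hx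

lemma mem_or_mem_frontier (hΩ : IsBoundedDomain Ω) {x : EuclideanSpace ℝ (Fin N)}
    (hx : x ∈ closure Ω) : x ∈ Ω ∨ x ∈ frontier Ω := by
  rw [hΩ.isOpen.frontier_eq]
  by_cases h : x ∈ Ω
  · exact Or.inl h
  · exact Or.inr ⟨hx, h⟩

lemma infDist_pos (hΩ : IsBoundedDomain Ω) {x : EuclideanSpace ℝ (Fin N)} (hx : x ∈ Ω) :
    0 < infDist x (frontier Ω) :=
  (isClosed_frontier.notMem_iff_infDist_pos hΩ.frontier_nonempty).1 (hΩ.notMem_frontier hx)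

lemma rEps_pos (hΩ : IsBoundedDomain Ω) (hε : 0 < ε) {x : EuclideanSpace ℝ (Fin N)}
    (hx : x ∈ Ω) : 0 < rEps ε Ω x :=
  lt_min hε (hΩ.infDist_pos hx)

lemma ball_subset (hΩ : IsBoundedDomain Ω) {x : EuclideanSpace ℝ (Fin N)} (hx : x ∈ Ω) :
    ball x (infDist x (frontier Ω)) ⊆ Ω := by
  refine (convex_ball x _).isPreconnected.subset_of_closure_inter_subset hΩ.isOpen
    ⟨x, mem_ball_self (hΩ.infDist_pos hx), hx⟩ ?_
  rintro y ⟨hy, hyb⟩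
  refine (hΩ.mem_or_mem_frontier hy).resolve_right fun hyf => ?_
  rw [mem_ball, dist_comm] at hyb
  exact hyb.not_ge (infDist_le_dist_of_mem hyf)

end IsBoundedDomain

lemma rEps_eq_zero (hε : 0 < ε) {x : EuclideanSpace ℝ (Fin N)} (hx : x ∈ frontier Ω) :
    rEps ε Ω x = 0 := by
  rw [rEps, infDist_zero_of_mem hx, min_eq_right hε.le]

lemma ballMap_of_mem_frontier (hε : 0 < ε) {x : EuclideanSpace ℝ (Fin N)}
    (hx : x ∈ frontier Ω) (h : EuclideanSpace ℝ (Fin N)) : ballMap ε Ω x h = x := by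
  simp [ballMap, rEps_eq_zero hε hx]

lemma continuous_ballMap (x : EuclideanSpace ℝ (Fin N)) : Continuous (ballMap ε Ω x) := by
  unfold ballMap
  fun_prop

namespace IsBoundedDomain

lemma ballMap_mem (hΩ : IsBoundedDomain Ω) (hε : 0 < ε) {x h : EuclideanSpace ℝ (Fin N)}
    (hx : x ∈ Ω) (hh : h ∈ ball 0 1) : ballMap ε Ω x h ∈ Ω := by
  refine hΩ.ball_subset hx ?_
  have hr := hΩ.rEps_pos hε hx
  have hh' : ‖h‖ < 1 := by simpa using hh
  have : ‖rEps ε Ω x • h‖ < rEps ε Ω x := by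
    rw [norm_smul, Real.norm_eq_abs, abs_of_pos hr]
    exact mul_lt_of_lt_one_right hr hh'
  simpa [ballMap] using this.trans_le (min_le_right _ _)

lemma ballMap_mem_closure (hΩ : IsBoundedDomain Ω) (hε : 0 < ε)
    {x h : EuclideanSpace ℝ (Fin N)} (hx : x ∈ closure Ω) (hh : h ∈ closedBall 0 1) :
    ballMap ε Ω x h ∈ closure Ω := by
  rcases hΩ.mem_or_mem_frontier hx with hx' | hx'
  · rw [← closure_ball _ one_ne_zero] at hh
    exact map_mem_closure (continuous_ballMap x) hh fun h hh => hΩ.ballMap_mem hε hx' hh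
  · rwa [ballMap_of_mem_frontier hε hx']

lemma continuousOn_comp_ballMap (hΩ : IsBoundedDomain Ω) (hε : 0 < ε)
    (hv : ContinuousOn v (closure Ω)) {x : EuclideanSpace ℝ (Fin N)} (hx : x ∈ closure Ω) :
    ContinuousOn (fun h => v (ballMap ε Ω x h)) (closedBall 0 1) :=
  hv.comp (continuous_ballMap x).continuousOn fun _ hh => hΩ.ballMap_mem_closure hε hx hh

lemma muEps_eq (hΩ : IsBoundedDomain Ω) (hp : 1 < p) (hε : 0 < ε)
    {x : EuclideanSpace ℝ (Fin N)} (hx : x ∈ closure Ω) :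
    muEps p ε Ω v x = pMean p (unitBallMeasure N) fun h => v (ballMap ε Ω x h) := by
  rcases hΩ.mem_or_mem_frontier hx with hx' | hx'
  · rw [muEps, if_pos hx', pMean_ball_eq v x (hΩ.rEps_pos hε hx')]
    rfl
  · rw [muEps, if_neg (hΩ.notMem_of_mem_frontier hx')]
    simp only [ballMap_of_mem_frontier hε hx', pMean_const hp]

lemma muEps_le_iff (hΩ : IsBoundedDomain Ω) (hp : 1 < p) (hε : 0 < ε)
    (hv : ContinuousOn v (closure Ω)) {x : EuclideanSpace ℝ (Fin N)} (hx : x ∈ closure Ω)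
    {m : ℝ} : muEps p ε Ω v x ≤ m ↔ MeanLE p (fun h => v (ballMap ε Ω x h)) m := by
  rw [hΩ.muEps_eq hp hε hx, pMean_le_iff hp (hΩ.continuousOn_comp_ballMap hε hv hx)]

lemma le_muEps_iff (hΩ : IsBoundedDomain Ω) (hp : 1 < p) (hε : 0 < ε)
    (hv : ContinuousOn v (closure Ω)) {x : EuclideanSpace ℝ (Fin N)} (hx : x ∈ closure Ω)
    {m : ℝ} : m ≤ muEps p ε Ω v x ↔ MeanLE p (fun h => -v (ballMap ε Ω x h)) (-m) := by
  rw [hΩ.muEps_eq hp hε hx, le_pMean_iff hp (hΩ.continuousOn_comp_ballMap hε hv hx)]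
  rfl

lemma muEps_neg (hΩ : IsBoundedDomain Ω) (hp : 1 < p) (hε : 0 < ε)
    (hv : ContinuousOn v (closure Ω)) {x : EuclideanSpace ℝ (Fin N)} (hx : x ∈ closure Ω) :
    muEps p ε Ω (-v) x = -muEps p ε Ω v x := by
  rw [hΩ.muEps_eq hp hε hx, hΩ.muEps_eq hp hε hx,
    ← pMean_neg hp (hΩ.continuousOn_comp_ballMap hε hv hx)]
  rfl

lemma muEps_mono (hΩ : IsBoundedDomain Ω) (hp : 1 < p) (hε : 0 < ε)
    (hv : ContinuousOn v (closure Ω)) (hw : ContinuousOn w (closure Ω))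
    (hvw : ∀ x ∈ closure Ω, v x ≤ w x) {x : EuclideanSpace ℝ (Fin N)} (hx : x ∈ closure Ω) :
    muEps p ε Ω v x ≤ muEps p ε Ω w x := by
  rw [hΩ.muEps_eq hp hε hx, hΩ.muEps_eq hp hε hx]
  exact pMean_mono hp (hΩ.continuousOn_comp_ballMap hε hv hx)
    (hΩ.continuousOn_comp_ballMap hε hw hx)
    fun h hh => hvw _ (hΩ.ballMap_mem_closure hε hx hh)

end IsBoundedDomain

lemma dist_ballMap_le (x y : EuclideanSpace ℝ (Fin N)) {h : EuclideanSpace ℝ (Fin N)}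
    (hh : h ∈ closedBall 0 1) : dist (ballMap ε Ω x h) (ballMap ε Ω y h) ≤ 2 * dist x y := by
  have h1 : |rEps ε Ω x - rEps ε Ω y| ≤ dist x y := by
    refine (abs_min_sub_min_le_max _ _ _ _).trans (max_le (by simp) ?_)
    have := (lipschitz_infDist_pt (frontier Ω)).dist_le_mul x y
    simpa [Real.dist_eq] using this
  have hh' : ‖h‖ ≤ 1 := by simpa using hh
  calc dist (ballMap ε Ω x h) (ballMap ε Ω y h)
      ≤ dist x y + dist (rEps ε Ω x • h) (rEps ε Ω y • h) := dist_add_add_le _ _ _ _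
    _ = dist x y + |rEps ε Ω x - rEps ε Ω y| * ‖h‖ := by
        rw [dist_eq_norm (rEps ε Ω x • h), ← sub_smul, norm_smul, Real.norm_eq_abs]
    _ ≤ dist x y + dist x y * 1 := by gcongr
    _ = 2 * dist x y := by ring

lemma IsBoundedDomain.continuousOn_muEps (hΩ : IsBoundedDomain Ω) (hp : 1 < p) (hε : 0 < ε)
    (hv : ContinuousOn v (closure Ω)) : ContinuousOn (muEps p ε Ω v) (closure Ω) := by
  have huc := hΩ.isCompact_closure.uniformContinuousOn_of_continuous hv
  rw [Metric.continuousOn_iff]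
  intro x hx δ hδ
  obtain ⟨η, hη, H⟩ := Metric.uniformContinuousOn_iff.1 huc (δ / 2) (half_pos hδ)
  refine ⟨η / 2, half_pos hη, fun y hy hyx => ?_⟩
  rw [hΩ.muEps_eq hp hε hx, hΩ.muEps_eq hp hε hy, Real.dist_eq]
  refine (abs_pMean_sub_pMean_le hp (hΩ.continuousOn_comp_ballMap hε hv hy)
    (hΩ.continuousOn_comp_ballMap hε hv hx) (δ := δ / 2) fun h hh => ?_).trans_lt (half_lt_self hδ)
  refine (H _ (hΩ.ballMap_mem_closure hε hy hh) _ (hΩ.ballMap_mem_closure hε hx hh) ?_).le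
  exact (dist_ballMap_le y x hh).trans_lt (by linarith)

/-- A nonempty compact subset of `Ω` does not contain all the balls `B_{r_ε(x)}(x)` centred at
its points. -/
lemma IsBoundedDomain.exists_ballMap_notMem (hΩ : IsBoundedDomain Ω) (hε : 0 < ε)
    {A : Set (EuclideanSpace ℝ (Fin N))} (hA : IsCompact A) (hne : A.Nonempty) (hAΩ : A ⊆ Ω) :
    ∃ x ∈ A, ∃ h ∈ ball (0 : EuclideanSpace ℝ (Fin N)) 1, ballMap ε Ω x h ∉ A := by
  obtain ⟨x, hx, hmin⟩ := hA.exists_isMinOn hne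
    (continuous_infDist_pt (frontier Ω)).continuousOn
  refine ⟨x, hx, ?_⟩
  by_contra! hcon
  obtain ⟨y, hy, hxy⟩ := hΩ.isCompact_frontier.exists_infDist_eq_dist hΩ.frontier_nonempty x
  have hd : 0 < dist x y := hxy ▸ hΩ.infDist_pos (hAΩ hx)
  have hr := hΩ.rEps_pos hε (hAΩ hx)
  have hrd : rEps ε Ω x ≤ dist x y := hxy ▸ min_le_right _ _
  set c : ℝ := (2 * dist x y)⁻¹ with hc
  have hc0 : 0 < c := by positivity
  have hnorm : ‖y - x‖ = dist x y := by rw [dist_comm, dist_eq_norm]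
  have hmem := hcon (c • (y - x)) (by
    rw [mem_ball_zero_iff, norm_smul, Real.norm_eq_abs, abs_of_pos hc0, hnorm, hc]
    field_simp
    norm_num)
  have hle : infDist x (frontier Ω) ≤ infDist (ballMap ε Ω x (c • (y - x))) (frontier Ω) :=
    hmin hmem
  have hdist : dist (ballMap ε Ω x (c • (y - x))) y = (1 - rEps ε Ω x * c) * dist x y := by
    have e : ballMap ε Ω x (c • (y - x)) - y = (1 - rEps ε Ω x * c) • (x - y) := by
      rw [ballMap]
      module
    have h1 : rEps ε Ω x * c ≤ 1 := by
      rw [hc, ← div_eq_mul_inv, div_le_one (by positivity)]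
      linarith
    rw [dist_eq_norm, e, norm_smul, Real.norm_eq_abs, abs_of_nonneg (by linarith), dist_eq_norm]
  have h2 := hle.trans (infDist_le_dist_of_mem hy)
  rw [hdist, hxy] at h2
  have : 0 < rEps ε Ω x * c * dist x y := by positivity
  linarith

end Domain

section Comparison

variable {N : ℕ} {p : ℝ≥0∞} {ε : ℝ} {Ω : Set (EuclideanSpace ℝ (Fin N))}
  {U u : EuclideanSpace ℝ (Fin N) → ℝ}

lemma UpperSemicontinuousOn.ae_ge_extend (hΩ : IsBoundedDomain Ω) (hε : 0 < ε)
    (hU : UpperSemicontinuousOn U (closure Ω)) {x : EuclideanSpace ℝ (Fin N)} (hx : x ∈ Ω) {M : ℝ}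
    (hae : ∀ᵐ h ∂unitBallMeasure N, M ≤ U (ballMap ε Ω x h))
    {h : EuclideanSpace ℝ (Fin N)} (hh : h ∈ ball 0 1) : M ≤ U (ballMap ε Ω x h) := by
  by_contra! hlt
  have hmem : ballMap ε Ω x h ∈ closure Ω := subset_closure (hΩ.ballMap_mem hε hx hh)
  have hball : ∀ᶠ k in 𝓝 h, k ∈ ball (0 : EuclideanSpace ℝ (Fin N)) 1 := isOpen_ball.mem_nhds hh
  have htend : Tendsto (ballMap ε Ω x) (𝓝 h) (𝓝[closure Ω] (ballMap ε Ω x h)) :=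
    tendsto_nhdsWithin_iff.2 ⟨(continuous_ballMap x).continuousAt,
      hball.mono fun k hk => subset_closure (hΩ.ballMap_mem hε hx hk)⟩
  have hev : ∀ᶠ k in 𝓝 h, U (ballMap ε Ω x k) < M ∧ k ∈ ball 0 1 :=
    (htend.eventually (hU _ hmem M hlt)).and hball
  rw [unitBallMeasure, ae_restrict_iff' measurableSet_ball] at hae
  exact absurd (measure_mono_null
    (fun k (hk : U (ballMap ε Ω x k) < M ∧ k ∈ ball 0 1) => fun hk' => (hk' hk.2).not_gt hk.1) hae)
    (Measure.measure_pos_of_mem_nhds volume hev).ne'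

/-- Comparison principle for semicontinuous sub- and supersolutions. -/
lemma IsBoundedDomain.comparison (hΩ : IsBoundedDomain Ω) (hp : 1 < p) (hε : 0 < ε)
    (hU : UpperSemicontinuousOn U (closure Ω)) (hu : LowerSemicontinuousOn u (closure Ω))
    (hUsub : ∀ x ∈ Ω, MeanLE p (fun h => -U (ballMap ε Ω x h)) (-U x))
    (husup : ∀ x ∈ Ω, MeanLE p (fun h => u (ballMap ε Ω x h)) (u x))
    (hbd : ∀ x ∈ frontier Ω, U x ≤ u x) : ∀ x ∈ closure Ω, U x ≤ u x := by
  have hD : UpperSemicontinuousOn (fun x => U x + (-u) x) (closure Ω) := hU.add hu.neg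
  obtain ⟨x₀, hx₀, hmax⟩ := hD.exists_isMaxOn
    (hΩ.frontier_nonempty.mono frontier_subset_closure) hΩ.isCompact_closure
  set M := U x₀ + (-u) x₀ with hM
  have hle : ∀ x ∈ closure Ω, U x ≤ u x + M := fun x hx => by
    have : U x + (-u) x ≤ M := hmax hx
    simp only [Pi.neg_apply] at this
    linarith
  rcases le_or_gt M 0 with hM0 | hM0
  · exact fun x hx => by linarith [hle x hx]
  exfalso
  set A := closure Ω ∩ (fun x => U x + (-u) x) ⁻¹' Set.Ici M with hAdef
  have hA : IsCompact A := hD.isCompact_inter_preimage_Ici hΩ.isCompact_closure M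
  have hAeq : ∀ x ∈ A, U x = u x + M := fun x hx =>
    le_antisymm (hle x hx.1) (by have : M ≤ U x + (-u) x := hx.2; simp at this; linarith)
  have hAmem : ∀ x ∈ closure Ω, u x + M ≤ U x → x ∈ A := fun x hx h =>
    ⟨hx, by simp only [Pi.neg_apply, Set.mem_preimage, Set.mem_Ici]; linarith⟩
  have hAΩ : A ⊆ Ω := fun x hx => (hΩ.mem_or_mem_frontier hx.1).resolve_right fun hxf => by
    linarith [hbd x hxf, hAeq x hx]
  have hAne : A.Nonempty := ⟨x₀, hx₀, hM.le⟩
  rcases eq_or_ne p ⊤ with rfl | hpt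
  · obtain ⟨a, ha, hamax⟩ := (hU.mono fun x hx => hx.1 : UpperSemicontinuousOn U A).exists_isMaxOn
      hAne hA
    obtain ⟨x, hx, k, hk, hxk⟩ := hΩ.exists_ballMap_notMem hε (A := A ∩ U ⁻¹' Set.Ici (U a))
      ((hU.mono fun x hx => hx.1 : UpperSemicontinuousOn U A).isCompact_inter_preimage_Ici hA _)
      ⟨a, ha, le_refl (U a)⟩ (Set.inter_subset_left.trans hAΩ)
    have hxA := hx.1
    have hUx : ∀ y ∈ A, U y ≤ U x := fun y hy => le_trans (hamax hy) hx.2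
    have hcl : ∀ h ∈ closedBall (0 : EuclideanSpace ℝ (Fin N)) 1, ballMap ε Ω x h ∈ closure Ω :=
      fun h hh => hΩ.ballMap_mem_closure hε hxA.1 hh
    have hcne : (closedBall (0 : EuclideanSpace ℝ (Fin N)) 1).Nonempty := ⟨0, by simp⟩
    obtain ⟨b, hb, hbmax⟩ := (hU.comp (continuous_ballMap x).continuousOn hcl).exists_isMaxOn
      hcne (isCompact_closedBall _ _)
    obtain ⟨c, hc, hcmin⟩ := (hu.comp (continuous_ballMap x).continuousOn hcl).exists_isMinOn
      hcne (isCompact_closedBall _ _)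
    have hbmax' : ∀ h ∈ closedBall (0 : EuclideanSpace ℝ (Fin N)) 1,
      U (ballMap ε Ω x h) ≤ U (ballMap ε Ω x b) := fun h hh => hbmax hh
    have hcmin' : ∀ h ∈ closedBall (0 : EuclideanSpace ℝ (Fin N)) 1,
      u (ballMap ε Ω x c) ≤ u (ballMap ε Ω x h) := fun h hh => hcmin hh
    have hsup : ∀ h ∈ closedBall (0 : EuclideanSpace ℝ (Fin N)) 1,
        u (ballMap ε Ω x h) + u (ballMap ε Ω x c) ≤ 2 * u x := fun h hh => by
      obtain ⟨z, hz, hle⟩ := (husup x (hAΩ hxA)).1 rfl h hh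
      linarith [hcmin' z hz]
    have hsub : ∀ h ∈ closedBall (0 : EuclideanSpace ℝ (Fin N)) 1,
        2 * U x ≤ U (ballMap ε Ω x h) + U (ballMap ε Ω x b) := fun h hh => by
      obtain ⟨z, hz, hle⟩ := (hUsub x (hAΩ hxA)).1 rfl h hh
      linarith [hbmax' z hz]
    have e := hAeq x hxA
    have h1 := hsup b hb
    have h2 := hsub c hc
    have h3 := hle _ (hcl b hb)
    have h4 := hle _ (hcl c hc)
    have h5 := hUx _ (hAmem _ (hcl b hb) (by linarith))
    have h6 := hUx _ (hAmem _ (hcl c hc) (by linarith))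
    have hkc := ball_subset_closedBall hk
    have h7 := hsup k hkc
    have h8 := hsub k hkc
    exact hxk ⟨hAmem _ (hcl k hkc) (by linarith),
      by simp only [Set.mem_preimage, Set.mem_Ici]; linarith [hUx a ha]⟩
  · have hq := toReal_sub_one_pos hp hpt
    obtain ⟨x, hx, k, hk, hxk⟩ := hΩ.exists_ballMap_notMem hε hA hAne hAΩ
    have hxΩ := hAΩ hx
    refine hxk (hAmem _ (subset_closure (hΩ.ballMap_mem hε hxΩ hk)) ?_)
    obtain ⟨hiu, hu0⟩ := (husup x hxΩ).2 hpt
    obtain ⟨hiU, hU0⟩ := (hUsub x hxΩ).2 hpt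
    have hneg (h : EuclideanSpace ℝ (Fin N)) : oddPow (p.toReal - 1) (-U (ballMap ε Ω x h) - -U x) =
        -oddPow (p.toReal - 1) (U (ballMap ε Ω x h) - U x) := by
      rw [← oddPow_neg]
      congr 1
      ring
    simp only [hneg] at hiU hU0
    have hsum := hiu.add hiU
    have hnonneg : 0 ≤ᵐ[unitBallMeasure N] fun h => oddPow (p.toReal - 1)
        (u (ballMap ε Ω x h) - u x) + -oddPow (p.toReal - 1) (U (ballMap ε Ω x h) - U x) := by
      filter_upwards [ae_mem_unitBall N] with h hh
      have h1 := hle _ (subset_closure (hΩ.ballMap_mem hε hxΩ hh))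
      have h2 := hAeq x hx
      have := (oddPow_strictMono hq).monotone
        (by linarith : U (ballMap ε Ω x h) - U x ≤ u (ballMap ε Ω x h) - u x)
      simp only [Pi.zero_apply]
      linarith
    have hzero := (integral_eq_zero_iff_of_nonneg_ae hnonneg hsum).1
      (le_antisymm (by rw [integral_add hiu hiU]; linarith) (integral_nonneg_of_ae hnonneg))
    have hae : ∀ᵐ h ∂unitBallMeasure N,
        M ≤ (fun y => U y + (-u) y) (ballMap ε Ω x h) := by
      filter_upwards [hzero] with h hh
      have heq : oddPow (p.toReal - 1) (u (ballMap ε Ω x h) - u x) =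
          oddPow (p.toReal - 1) (U (ballMap ε Ω x h) - U x) := by
        simp only [Pi.zero_apply] at hh
        linarith
      have := (oddPow_strictMono hq).injective heq
      simp only [Pi.neg_apply]
      linarith [hAeq x hx]
    have := hD.ae_ge_extend hΩ hε hxΩ hae hk
    simp only [Pi.neg_apply] at this
    linarith

lemma IsBoundedDomain.comparison_of_continuousOn (hΩ : IsBoundedDomain Ω) (hp : 1 < p)
    (hε : 0 < ε) (hU : ContinuousOn U (closure Ω)) (hu : ContinuousOn u (closure Ω))
    (hUsub : ∀ x ∈ Ω, U x ≤ muEps p ε Ω U x) (husup : ∀ x ∈ Ω, muEps p ε Ω u x ≤ u x)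
    (hbd : ∀ x ∈ frontier Ω, U x ≤ u x) : ∀ x ∈ closure Ω, U x ≤ u x :=
  hΩ.comparison hp hε hU.upperSemicontinuousOn hu.lowerSemicontinuousOn
    (fun x hx => (hΩ.le_muEps_iff hp hε hU (subset_closure hx)).1 (hUsub x hx))
    (fun x hx => (hΩ.muEps_le_iff hp hε hu (subset_closure hx)).1 (husup x hx)) hbd

end Comparison

lemma MeanLE.of_tendsto {N : ℕ} {p : ℝ≥0∞} (hp : 1 < p)
    {F : ℕ → EuclideanSpace ℝ (Fin N) → ℝ} {f : EuclideanSpace ℝ (Fin N) → ℝ} {m b : ℝ}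
    (hF : ∀ n, ContinuousOn (F n) (closedBall 0 1))
    (hmono : ∀ h ∈ closedBall 0 1, Monotone fun n => F n h)
    (hlim : ∀ h ∈ closedBall 0 1, Tendsto (fun n => F n h) atTop (𝓝 (f h)))
    (hb : ∀ n, ∀ h ∈ closedBall 0 1, F n h ≤ b) (hmean : ∀ n, MeanLE p (F n) m) :
    MeanLE p f m := by
  refine ⟨fun hpt y hy => ?_, fun hpt => ?_⟩
  · choose z hz hyz using fun n => (hmean n).1 hpt y hy
    obtain ⟨a, ha, φ, hφ, hφa⟩ := (isCompact_closedBall _ _).tendsto_subseq hz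
    have key (n : ℕ) : F n y + F n a ≤ 2 * m := by
      have hz' : Tendsto (z ∘ φ) atTop (𝓝[closedBall 0 1] a) :=
        tendsto_nhdsWithin_iff.2 ⟨hφa, .of_forall fun k => hz _⟩
      refine le_of_tendsto ((((hF n) a ha).tendsto.comp hz').const_add (F n y)) ?_
      filter_upwards [eventually_ge_atTop n] with k hk
      have hnk : n ≤ φ k := hk.trans (hφ.id_le k)
      have h1 : F n (z (φ k)) ≤ F (φ k) (z (φ k)) := hmono _ (hz _) hnk
      have h2 : F n y ≤ F (φ k) y := hmono _ hy hnk
      exact (add_le_add h2 h1).trans (hyz (φ k))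
    exact ⟨a, ha, le_of_tendsto ((hlim y hy).add (hlim a ha)) (.of_forall key)⟩
  · have hq := toReal_sub_one_pos hp hpt
    obtain ⟨C, hC⟩ := exists_bound_of_continuousOn (hF 0)
    set G : ℝ → ℝ := fun t => oddPow (p.toReal - 1) (t - m) with hG
    have hGc : Continuous G := (continuous_oddPow hq).comp (by fun_prop)
    have hGm : Monotone G := fun s t hst =>
      (oddPow_strictMono hq).monotone (sub_le_sub_right hst _)
    have hbound : ∀ n, ∀ᵐ h ∂unitBallMeasure N, ‖G (F n h)‖ ≤ max |G (-C)| |G b| := fun n => by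
      filter_upwards [ae_mem_unitBall N] with h hh
      have hh' := ball_subset_closedBall hh
      refine abs_le_max_abs_abs (hGm ?_) (hGm (hb n h hh'))
      exact (abs_le.1 (hC h hh')).1.trans (hmono h hh' (Nat.zero_le n))
    have hlimG : ∀ᵐ h ∂unitBallMeasure N, Tendsto (fun n => G (F n h)) atTop (𝓝 (G (f h))) := by
      filter_upwards [ae_mem_unitBall N] with h hh
      exact (hGc.tendsto _).comp (hlim h (ball_subset_closedBall hh))
    have hmeas (n : ℕ) : AEStronglyMeasurable (fun h => G (F n h)) (unitBallMeasure N) :=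
      (integrable_comp_of_continuousOn (hF n) hGc).aestronglyMeasurable
    have hint : Integrable (fun h => G (f h)) (unitBallMeasure N) := by
      refine Integrable.of_bound (aestronglyMeasurable_of_tendsto_ae _ hmeas hlimG)
        (max |G (-C)| |G b|) ?_
      filter_upwards [hlimG, ae_all_iff.2 hbound] with h hl hbd
      exact le_of_tendsto hl.norm (.of_forall hbd)
    refine ⟨hint, le_of_tendsto (tendsto_integral_of_dominated_convergence
      (fun _ => max |G (-C)| |G b|) hmeas (integrable_const _) hbound hlimG) ?_⟩
    exact .of_forall fun n => ((hmean n).2 hpt).2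

section Perron

variable {N : ℕ} {p : ℝ≥0∞} {ε : ℝ} {Ω : Set (EuclideanSpace ℝ (Fin N))}
  {g v w : EuclideanSpace ℝ (Fin N) → ℝ}

namespace IsBoundedDomain

lemma const_mem_SgLower (hΩ : IsBoundedDomain Ω) (hp : 1 < p) (hε : 0 < ε) {a : ℝ}
    (ha : ∀ x ∈ frontier Ω, a ≤ g x) : (fun _ => a) ∈ SgLower p ε Ω g :=
  ⟨continuousOn_const, fun x hx => by
    rw [hΩ.muEps_eq hp hε (subset_closure hx), pMean_const hp], ha⟩

lemma const_mem_SgUpper (hΩ : IsBoundedDomain Ω) (hp : 1 < p) (hε : 0 < ε) {a : ℝ}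
    (ha : ∀ x ∈ frontier Ω, g x ≤ a) : (fun _ => a) ∈ SgUpper p ε Ω g :=
  ⟨continuousOn_const, fun x hx => by
    rw [hΩ.muEps_eq hp hε (subset_closure hx), pMean_const hp], ha⟩

lemma sup_mem_SgLower (hΩ : IsBoundedDomain Ω) (hp : 1 < p) (hε : 0 < ε)
    (hv : v ∈ SgLower p ε Ω g) (hw : w ∈ SgLower p ε Ω g) : v ⊔ w ∈ SgLower p ε Ω g := by
  have hc : ContinuousOn (v ⊔ w) (closure Ω) := hv.1.sup hw.1
  refine ⟨hc, fun x hx => sup_le ((hv.2.1 x hx).trans ?_) ((hw.2.1 x hx).trans ?_),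
    fun x hx => sup_le (hv.2.2 x hx) (hw.2.2 x hx)⟩
  · exact hΩ.muEps_mono hp hε hv.1 hc (fun y _ => le_sup_left) (subset_closure hx)
  · exact hΩ.muEps_mono hp hε hw.1 hc (fun y _ => le_sup_right) (subset_closure hx)

lemma muEps_of_mem_frontier (hΩ : IsBoundedDomain Ω) {x : EuclideanSpace ℝ (Fin N)}
    (hx : x ∈ frontier Ω) : muEps p ε Ω v x = v x :=
  if_neg (hΩ.notMem_of_mem_frontier hx)

lemma le_muEps_of_mem_SgLower (hΩ : IsBoundedDomain Ω) (hv : v ∈ SgLower p ε Ω g)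
    {x : EuclideanSpace ℝ (Fin N)} (hx : x ∈ closure Ω) : v x ≤ muEps p ε Ω v x := by
  rcases hΩ.mem_or_mem_frontier hx with hx | hx
  · exact hv.2.1 x hx
  · exact (hΩ.muEps_of_mem_frontier hx).ge

lemma muEps_mem_SgLower (hΩ : IsBoundedDomain Ω) (hp : 1 < p) (hε : 0 < ε)
    (hv : v ∈ SgLower p ε Ω g) : muEps p ε Ω v ∈ SgLower p ε Ω g := by
  have hc := hΩ.continuousOn_muEps hp hε hv.1
  refine ⟨hc, fun x hx => ?_, fun x hx => ?_⟩
  · exact hΩ.muEps_mono hp hε hv.1 hc (fun y hy => hΩ.le_muEps_of_mem_SgLower hv hy)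
      (subset_closure hx)
  · rw [hΩ.muEps_of_mem_frontier hx]
    exact hv.2.2 x hx

lemma le_of_mem_SgLower_of_mem_SgUpper (hΩ : IsBoundedDomain Ω) (hp : 1 < p) (hε : 0 < ε)
    (hv : v ∈ SgLower p ε Ω g) (hw : w ∈ SgUpper p ε Ω g) : ∀ x ∈ closure Ω, v x ≤ w x :=
  hΩ.comparison_of_continuousOn hp hε hv.1 hw.1 hv.2.1 hw.2.1
    fun x hx => (hv.2.2 x hx).trans (hw.2.2 x hx)

lemma neg_mem_SgUpper (hΩ : IsBoundedDomain Ω) (hp : 1 < p) (hε : 0 < ε)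
    (hv : v ∈ SgLower p ε Ω (-g)) : -v ∈ SgUpper p ε Ω g := by
  refine ⟨hv.1.neg, fun x hx => ?_, fun x hx => ?_⟩
  · rw [hΩ.muEps_neg hp hε hv.1 (subset_closure hx)]
    exact neg_le_neg (hv.2.1 x hx)
  · exact le_neg.1 (hv.2.2 x hx)

/-- Near a regular boundary point there are subsolutions almost attaining the boundary datum. -/
lemma exists_mem_SgLower_near (hΩ : IsBoundedDomain Ω) (hp : 1 < p) (hε : 0 < ε)
    (hg : ContinuousOn g (frontier Ω)) {x₀ : EuclideanSpace ℝ (Fin N)} (hx₀ : x₀ ∈ frontier Ω)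
    (hw : IsBarrier p ε Ω x₀ w) {δ : ℝ} (hδ : 0 < δ) :
    ∃ t ∈ 𝓝[frontier Ω] x₀, ∃ v ∈ SgLower p ε Ω g, ∀ x ∈ t, g x - δ ≤ v x := by
  obtain ⟨hwc, hwsup, hwpos, hw0⟩ := hw
  obtain ⟨B, hB⟩ := hΩ.isCompact_frontier.exists_bound_of_continuousOn hg
  have hgb : ∀ x ∈ frontier Ω, |g x| ≤ B := hB
  have hnear : ∀ᶠ x in 𝓝[frontier Ω] x₀, |g x - g x₀| < δ / 4 := by
    simpa [Real.dist_eq] using (Metric.tendsto_nhds.1 (hg x₀ hx₀).tendsto) (δ / 4) (by linarith)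
  obtain ⟨O, hO, hx₀O, hOsub⟩ := mem_nhdsWithin.1 hnear
  obtain ⟨κ, hκ, hκw⟩ : ∃ κ > 0, ∀ x ∈ frontier Ω \ O, κ ≤ w x := by
    rcases (frontier Ω \ O).eq_empty_or_nonempty with he | hne
    · exact ⟨1, one_pos, fun x hx => by simp [he] at hx⟩
    · obtain ⟨y, hy, hmin⟩ := (hΩ.isCompact_frontier.diff hO).exists_isMinOn hne
        (hwc.mono fun x hx => frontier_subset_closure hx.1)
      exact ⟨w y, hwpos y (frontier_subset_closure hy.1) (fun h => hy.2 (h ▸ hx₀O)), hmin⟩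
  have hB0 : 0 ≤ B := (abs_nonneg _).trans (hgb x₀ hx₀)
  set c := 2 * B / κ with hcdef
  have hc : 0 ≤ c := by positivity
  set v : EuclideanSpace ℝ (Fin N) → ℝ := fun x => (g x₀ - δ / 4) - c * w x with hv
  have hvc : ContinuousOn v (closure Ω) := continuousOn_const.sub (continuousOn_const.mul hwc)
  have hwnn : ∀ x ∈ closure Ω, 0 ≤ w x := fun x hx => by
    rcases eq_or_ne x x₀ with rfl | h
    · exact hw0.ge
    · exact (hwpos x hx h).le
  have hlim : ∀ᶠ x in 𝓝[frontier Ω] x₀, g x₀ - δ / 2 < v x := by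
    have : Tendsto v (𝓝[frontier Ω] x₀) (𝓝 (v x₀)) :=
      (hvc x₀ (frontier_subset_closure hx₀)).mono_left
        (nhdsWithin_mono _ frontier_subset_closure)
    refine this.eventually (lt_mem_nhds ?_)
    simp only [hv, hw0]
    linarith
  refine ⟨_, hnear.and hlim, v, ⟨hvc, fun x hx => ?_, fun x hx => ?_⟩, fun x hx => ?_⟩
  · have hx' := subset_closure hx
    rw [hΩ.le_muEps_iff hp hε hvc hx']
    convert ((hΩ.muEps_le_iff hp hε hwc hx').1 (hwsup x hx)).affine (-(g x₀ - δ / 4)) hc using 2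
    · simp only [hv]
      ring
    · simp only [hv]
      ring
  · have h0 := hwnn x (frontier_subset_closure hx)
    by_cases hxO : x ∈ O
    · have h1 : |g x - g x₀| < δ / 4 := hOsub ⟨hxO, hx⟩
      rw [abs_lt] at h1
      have h2 : 0 ≤ c * w x := by positivity
      simp only [hv]
      linarith
    · have h1 : c * κ ≤ c * w x := mul_le_mul_of_nonneg_left (hκw x ⟨hx, hxO⟩) hc
      have h2 : c * κ = 2 * B := by
        rw [hcdef]
        field_simp
      have h3 := abs_le.1 (hgb x hx)
      have h4 := abs_le.1 (hgb x₀ hx₀)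
      simp only [hv]
      linarith
  · have h1 := (abs_lt.1 hx.1).2
    have h2 : g x₀ - δ / 2 < v x := hx.2
    linarith

lemma exists_mem_SgLower_ge (hΩ : IsBoundedDomain Ω) (hp : 1 < p) (hε : 0 < ε)
    (hbar : ∀ x₀ ∈ frontier Ω, ∃ w, IsBarrier p ε Ω x₀ w)
    (hg : ContinuousOn g (frontier Ω)) {δ : ℝ} (hδ : 0 < δ) :
    ∃ v ∈ SgLower p ε Ω g, ∀ x ∈ frontier Ω, g x - δ ≤ v x := by
  refine hΩ.isCompact_frontier.induction_on
    (p := fun s => ∃ v ∈ SgLower p ε Ω g, ∀ x ∈ s, g x - δ ≤ v x) ?_ ?_ ?_ ?_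
  · obtain ⟨B, hB⟩ := hΩ.isCompact_frontier.exists_bound_of_continuousOn hg
    exact ⟨fun _ => -B, hΩ.const_mem_SgLower hp hε fun x hx => (abs_le.1 (hB x hx)).1, by simp⟩
  · rintro s t hst ⟨v, hv, hvt⟩
    exact ⟨v, hv, fun x hx => hvt x (hst hx)⟩
  · rintro s t ⟨v, hv, hvs⟩ ⟨w, hw, hwt⟩
    refine ⟨v ⊔ w, hΩ.sup_mem_SgLower hp hε hv hw, ?_⟩
    rintro x (hx | hx)
    · exact (hvs x hx).trans le_sup_left
    · exact (hwt x hx).trans le_sup_right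
  · intro x hx
    obtain ⟨w, hw⟩ := hbar x hx
    exact hΩ.exists_mem_SgLower_near hp hε hg hx hw hδ

/-- If all boundary points are regular, there is an increasing sequence of continuous subsolutions
converging to a lower semicontinuous supersolution with the prescribed boundary values. -/
lemma exists_tendsto_SgLower (hΩ : IsBoundedDomain Ω) (hp : 1 < p) (hε : 0 < ε)
    (hbar : ∀ x₀ ∈ frontier Ω, ∃ w, IsBarrier p ε Ω x₀ w)
    (hg : ContinuousOn g (frontier Ω)) :
    ∃ (F : ℕ → EuclideanSpace ℝ (Fin N) → ℝ) (u : EuclideanSpace ℝ (Fin N) → ℝ),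
      (∀ n, F n ∈ SgLower p ε Ω g) ∧
      (∀ x ∈ closure Ω, Tendsto (fun n => F n x) atTop (𝓝 (u x))) ∧
      LowerSemicontinuousOn u (closure Ω) ∧
      (∀ x ∈ Ω, MeanLE p (fun h => u (ballMap ε Ω x h)) (u x)) ∧
      Set.EqOn u g (frontier Ω) := by
  choose v hv hvg using fun n : ℕ =>
    hΩ.exists_mem_SgLower_ge hp hε hbar hg (δ := 1 / ((n : ℝ) + 1)) Nat.one_div_pos_of_nat
  let F : ℕ → EuclideanSpace ℝ (Fin N) → ℝ := fun n =>
    n.rec (v 0) fun n f => muEps p ε Ω f ⊔ v (n + 1)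
  have hFsucc (n : ℕ) : F (n + 1) = muEps p ε Ω (F n) ⊔ v (n + 1) := rfl
  have hF (n : ℕ) : F n ∈ SgLower p ε Ω g := by
    induction n with
    | zero => exact hv 0
    | succ n ih => exact hΩ.sup_mem_SgLower hp hε (hΩ.muEps_mem_SgLower hp hε ih) (hv (n + 1))
  have hmu (n : ℕ) (x : EuclideanSpace ℝ (Fin N)) : muEps p ε Ω (F n) x ≤ F (n + 1) x := by
    rw [hFsucc]
    exact le_sup_left
  have hmono : ∀ x ∈ closure Ω, Monotone fun n => F n x := fun x hx =>
    monotone_nat_of_le_succ fun n => (hΩ.le_muEps_of_mem_SgLower (hF n) hx).trans (hmu n x)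
  have hvF (n : ℕ) (x : EuclideanSpace ℝ (Fin N)) : v n x ≤ F n x := by
    cases n with
    | zero => exact le_rfl
    | succ n =>
      rw [hFsucc]
      exact le_sup_right
  obtain ⟨B, hB⟩ := hΩ.isCompact_frontier.exists_bound_of_continuousOn hg
  have hFB (n : ℕ) : ∀ x ∈ closure Ω, F n x ≤ B :=
    hΩ.le_of_mem_SgLower_of_mem_SgUpper hp hε (hF n)
      (hΩ.const_mem_SgUpper hp hε fun x hx => (abs_le.1 (hB x hx)).2)
  have hbdd : ∀ x ∈ closure Ω, BddAbove (Set.range fun n => F n x) := fun x hx =>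
    ⟨B, Set.forall_mem_range.2 fun n => hFB n x hx⟩
  have hlim : ∀ x ∈ closure Ω, Tendsto (fun n => F n x) atTop (𝓝 (⨆ n, F n x)) := fun x hx =>
    tendsto_atTop_ciSup (hmono x hx) (hbdd x hx)
  refine ⟨F, fun x => ⨆ n, F n x, hF, hlim, ?_, fun x hx => ?_, fun x hx => ?_⟩
  · exact lowerSemicontinuousOn_ciSup hbdd fun n => (hF n).1.lowerSemicontinuousOn
  · have hx' := subset_closure hx
    have hcl {h : EuclideanSpace ℝ (Fin N)} (hh : h ∈ closedBall 0 1) :=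
      hΩ.ballMap_mem_closure hε hx' hh
    exact MeanLE.of_tendsto hp (fun n => hΩ.continuousOn_comp_ballMap hε (hF n).1 hx')
      (fun h hh => hmono _ (hcl hh)) (fun h hh => hlim _ (hcl hh))
      (fun n h hh => hFB n _ (hcl hh)) fun n =>
      (hΩ.muEps_le_iff hp hε (hF n).1 hx').1 ((hmu n x).trans (le_ciSup (hbdd x hx') (n + 1)))
  · refine tendsto_nhds_unique (hlim x (frontier_subset_closure hx)) ?_
    refine tendsto_of_tendsto_of_tendsto_of_le_of_le (g := fun n : ℕ => g x - 1 / ((n : ℝ) + 1))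
      ?_ tendsto_const_nhds (fun n => (hvg n x hx).trans (hvF n x)) fun n => (hF n).2.2 x hx
    simpa using (tendsto_one_div_add_atTop_nhds_zero_nat (𝕜 := ℝ)).const_sub (g x)

/-- If all boundary points are regular, the Dirichlet problem is solvable. -/
lemma exists_isDirichletSolution (hΩ : IsBoundedDomain Ω) (hp : 1 < p) (hε : 0 < ε)
    (hbar : ∀ x₀ ∈ frontier Ω, ∃ w, IsBarrier p ε Ω x₀ w)
    (hg : ContinuousOn g (frontier Ω)) : ∃ u, IsDirichletSolution p ε Ω g u := by
  obtain ⟨F, u, hF, hFu, hu, husup, hug⟩ := hΩ.exists_tendsto_SgLower hp hε hbar hg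
  obtain ⟨F', u', hF', hFu', hu', husup', hug'⟩ :=
    hΩ.exists_tendsto_SgLower hp hε hbar (g := -g) hg.neg
  have hle1 : ∀ x ∈ closure Ω, u x ≤ (-u') x := fun x hx => by
    refine le_of_tendsto' (hFu x hx) fun n => ge_of_tendsto' (hFu' x hx).neg fun m => ?_
    exact hΩ.le_of_mem_SgLower_of_mem_SgUpper hp hε (hF n) (hΩ.neg_mem_SgUpper hp hε (hF' m)) x hx
  have hle2 : ∀ x ∈ closure Ω, (-u') x ≤ u x := by
    refine hΩ.comparison hp hε hu'.neg hu (fun x hx => ?_) husup fun x hx => ?_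
    · simpa using husup' x hx
    · simp [hug hx, hug' hx]
  have heq : Set.EqOn u (-u') (closure Ω) := fun x hx => (hle1 x hx).antisymm (hle2 x hx)
  have huc : ContinuousOn u (closure Ω) :=
    continuousOn_iff_lower_upperSemicontinuousOn.2 ⟨hu, fun x hx => UpperSemicontinuousWithinAt.congr_of_eventuallyEq
      (hu'.neg x hx) hx heq.symm.eventuallyEq_nhdsWithin⟩
  have huc' : ContinuousOn u' (closure Ω) := by
    simpa using (huc.congr heq.symm).neg
  refine ⟨u, huc, fun x hx => le_antisymm ?_ ?_, hug⟩
  · have hx' := subset_closure hx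
    rw [hΩ.le_muEps_iff hp hε huc hx', heq hx']
    simp only [Pi.neg_apply, neg_neg]
    refine (husup' x hx).of_le hp (hΩ.continuousOn_comp_ballMap hε huc hx').neg fun h hh => ?_
    simp [heq (hΩ.ballMap_mem_closure hε hx' hh)]
  · exact (hΩ.muEps_le_iff hp hε huc (subset_closure hx)).2 (husup x hx)

end IsBoundedDomain

variable {u : EuclideanSpace ℝ (Fin N) → ℝ}

lemma IsDirichletSolution.mem_SgLower (hu : IsDirichletSolution p ε Ω g u) :
    u ∈ SgLower p ε Ω g :=
  ⟨hu.1, fun x hx => (hu.2.1 x hx).le, fun x hx => (hu.2.2 x hx).le⟩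

lemma IsDirichletSolution.mem_SgUpper (hu : IsDirichletSolution p ε Ω g u) :
    u ∈ SgUpper p ε Ω g :=
  ⟨hu.1, fun x hx => (hu.2.1 x hx).ge, fun x hx => (hu.2.2 x hx).ge⟩

lemma IsDirichletSolution.eqOn_lowerPerron (hu : IsDirichletSolution p ε Ω g u)
    (hΩ : IsBoundedDomain Ω) (hp : 1 < p) (hε : 0 < ε) :
    Set.EqOn u (lowerPerron p ε Ω g) (closure Ω) := fun x hx =>
  have h : IsGreatest ((fun v => v x) '' SgLower p ε Ω g) (u x) :=
    ⟨⟨u, hu.mem_SgLower, rfl⟩, Set.forall_mem_image.2 fun _ hv =>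
      hΩ.le_of_mem_SgLower_of_mem_SgUpper hp hε hv hu.mem_SgUpper x hx⟩
  h.csSup_eq.symm

lemma IsDirichletSolution.eqOn_upperPerron (hu : IsDirichletSolution p ε Ω g u)
    (hΩ : IsBoundedDomain Ω) (hp : 1 < p) (hε : 0 < ε) :
    Set.EqOn u (upperPerron p ε Ω g) (closure Ω) := fun x hx =>
  have h : IsLeast ((fun v => v x) '' SgUpper p ε Ω g) (u x) :=
    ⟨⟨u, hu.mem_SgUpper, rfl⟩, Set.forall_mem_image.2 fun _ hv =>
      hΩ.le_of_mem_SgLower_of_mem_SgUpper hp hε hu.mem_SgLower hv x hx⟩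
  h.csInf_eq.symm

end Perron

section ExpEstimates

variable {q y s : ℝ}

lemma one_add_pow_le (N : ℕ) {δ : ℝ} (hδ : 0 ≤ δ) (hδ1 : δ ≤ 1) :
    (1 + δ) ^ N ≤ 1 + 3 ^ N * δ := by
  induction N with
  | zero => simpa using hδ
  | succ n ih =>
    have h3 : (1 : ℝ) ≤ 3 ^ n := one_le_pow₀ (by norm_num)
    calc (1 + δ) ^ (n + 1) ≤ (1 + 3 ^ n * δ) * (1 + δ) := by
          rw [pow_succ]
          gcongr
      _ ≤ 1 + 3 ^ (n + 1) * δ := by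
          rw [pow_succ]
          nlinarith [mul_nonneg hδ (sub_nonneg.2 hδ1), mul_nonneg hδ (sub_nonneg.2 h3),
            mul_nonneg (mul_nonneg hδ (sub_nonneg.2 hδ1)) (zero_le_one.trans h3)]

lemma abs_oddPow_one_sub_exp_le (hq : 0 < q) (hy : 0 < y) (hy4 : y ≤ 1 / 4) (hs : |s| ≤ 2) :
    |oddPow q (1 - Real.exp (-2 * y * s))| ≤ (8 * y) ^ q := by
  have h1 : |-2 * y * s| ≤ 4 * y := by
    rw [abs_mul, abs_mul, abs_of_pos hy]
    norm_num
    nlinarith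
  have h2 := Real.abs_exp_sub_one_le (h1.trans (by linarith))
  rw [abs_sub_comm] at h2
  have h3 := abs_le.1 (h2.trans (by linarith : 2 * |-2 * y * s| ≤ 8 * y))
  have hm := (oddPow_strictMono hq).monotone
  have h8 := oddPow_of_nonneg hq (by positivity : 0 ≤ 8 * y)
  rw [← h8, abs_le, ← oddPow_neg]
  exact ⟨hm h3.1, hm h3.2⟩

lemma oddPow_one_sub_exp_add (hq : 0 < q) (hy : 0 < y) (hs : 0 ≤ s) :
    oddPow q (1 - Real.exp (-2 * y * s)) + oddPow q (1 - Real.exp (-2 * y * -s)) =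
      -((Real.exp (q * (2 * y * s)) - 1) * (1 - Real.exp (-2 * y * s)) ^ q) := by
  have h1 : Real.exp (-2 * y * s) ≤ 1 := Real.exp_le_one_iff.2 (by nlinarith [mul_nonneg hy.le hs])
  have h2 : 1 - Real.exp (-2 * y * -s) =
      -(Real.exp (2 * y * s) * (1 - Real.exp (-2 * y * s))) := by
    rw [mul_sub, ← Real.exp_add, mul_neg, neg_mul, neg_mul, neg_neg, mul_one, add_neg_cancel,
      Real.exp_zero]
    ring
  rw [h2, oddPow_neg, oddPow_mul (Real.exp_pos _).le, oddPow_of_nonneg hq (by linarith),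
    ← Real.exp_mul, mul_comm (2 * y * s) q]
  ring

lemma oddPow_one_sub_exp_add_nonpos (hq : 0 < q) (hy : 0 < y) (s : ℝ) :
    oddPow q (1 - Real.exp (-2 * y * s)) + oddPow q (1 - Real.exp (-2 * y * -s)) ≤ 0 := by
  wlog hs : 0 ≤ s generalizing s
  · have := this (-s) (by linarith)
    rw [neg_neg, add_comm] at this
    exact this
  rw [oddPow_one_sub_exp_add hq hy hs, neg_nonpos]
  have hys := mul_nonneg hy.le hs
  have h1 : 1 ≤ Real.exp (q * (2 * y * s)) := Real.one_le_exp (by positivity)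
  have h2 : Real.exp (-2 * y * s) ≤ 1 := Real.exp_le_one_iff.2 (by linarith)
  exact mul_nonneg (by linarith) (Real.rpow_nonneg (by linarith) _)

lemma oddPow_one_sub_exp_add_le (hq : 0 < q) (hy : 0 < y) (hy1 : y ≤ 1) (hs : 1 / 2 ≤ s) :
    oddPow q (1 - Real.exp (-2 * y * s)) + oddPow q (1 - Real.exp (-2 * y * -s)) ≤
      -(q * y * (y / 2) ^ q) := by
  rw [oddPow_one_sub_exp_add hq hy (by linarith), neg_le_neg_iff]
  have h0 : y ≤ 2 * y * s := by nlinarith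
  have h1 : q * y ≤ Real.exp (q * (2 * y * s)) - 1 := by
    have := Real.add_one_le_exp (q * (2 * y * s))
    have := mul_le_mul_of_nonneg_left h0 hq.le
    linarith
  have h2 : y / 2 ≤ 1 - Real.exp (-2 * y * s) := by
    have e1 : Real.exp (-2 * y * s) ≤ Real.exp (-y) := Real.exp_le_exp.2 (by linarith)
    have e2 : Real.exp (-y) * Real.exp y = 1 := by rw [← Real.exp_add]; simp
    have e3 := Real.add_one_le_exp y
    have e4 := Real.exp_pos (-y)
    nlinarith
  exact mul_le_mul h1 (Real.rpow_le_rpow (by positivity) h2 hq.le) (by positivity)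
    ((by positivity : 0 ≤ q * y).trans h1)

end ExpEstimates

section BallIntegrals

variable {N : ℕ} {φ : EuclideanSpace ℝ (Fin N) → ℝ}

lemma Continuous.integrableOn_ball (hφ : Continuous φ) (x : EuclideanSpace ℝ (Fin N)) (r : ℝ) :
    IntegrableOn φ (ball x r) volume :=
  (hφ.continuousOn.integrableOn_compact (isCompact_closedBall x r)).mono_set ball_subset_closedBall

lemma volume_real_ball (x : EuclideanSpace ℝ (Fin N)) {r : ℝ} (hr : 0 < r) :
    volume.real (ball x r) =
      r ^ N * volume.real (ball (0 : EuclideanSpace ℝ (Fin N)) 1) := by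
  rw [measureReal_def, Measure.addHaar_ball_of_pos _ _ hr, finrank_euclideanSpace_fin,
    ENNReal.toReal_mul, ENNReal.toReal_ofReal (by positivity), measureReal_def]

lemma setIntegral_ball_add_le (hφ : Continuous φ) {c δ : ℝ}
    (hc : ∀ h ∈ closedBall 0 2, |φ h| ≤ c) {a : EuclideanSpace ℝ (Fin N)} (ha : ‖a‖ ≤ δ)
    (hδ : δ ≤ 1) :
    ∫ h in ball 0 1, φ (h + a) ≤ (∫ h in ball 0 1, φ h) +
      2 * c * (3 ^ N * δ) * volume.real (ball (0 : EuclideanSpace ℝ (Fin N)) 1) := by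
  set ω := volume.real (ball (0 : EuclideanSpace ℝ (Fin N)) 1) with hω
  have hδ0 : 0 ≤ δ := (norm_nonneg a).trans ha
  have hc0 : 0 ≤ c := (abs_nonneg _).trans (hc 0 (by simp))
  have hpre : (fun h => h + a) ⁻¹' ball a 1 = ball 0 1 := by
    ext h
    simp
  have h1 : ∫ h in ball 0 1, φ (h + a) = ∫ h in ball a 1, φ h := by
    rw [← (measurePreserving_add_right volume a).setIntegral_preimage_emb
      (measurableEmbedding_addRight a) φ, hpre]
  have hconst (x : EuclideanSpace ℝ (Fin N)) (r : ℝ) :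
      IntegrableOn (fun _ => c) (ball x r) volume := continuous_const.integrableOn_ball x r
  have h2 (x : EuclideanSpace ℝ (Fin N)) {r : ℝ} (hr : 0 < r) :
      ∫ h in ball x r, (φ h + c) = (∫ h in ball x r, φ h) + c * (r ^ N * ω) := by
    rw [integral_add (hφ.integrableOn_ball x r) (hconst x r), setIntegral_const,
      volume_real_ball x hr, smul_eq_mul, mul_comm c]
  have hφc : Continuous fun h => φ h + c := by fun_prop
  have hsub1 : ball a 1 ⊆ ball 0 (1 + δ) := ball_subset_ball' (by simpa using ha)
  have hsub2 : ball (0 : EuclideanSpace ℝ (Fin N)) 1 ⊆ ball 0 (1 + δ) :=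
    ball_subset_ball (by linarith)
  have hsub3 : ball (0 : EuclideanSpace ℝ (Fin N)) (1 + δ) ⊆ closedBall 0 2 :=
    ball_subset_closedBall.trans (closedBall_subset_closedBall (by linarith))
  have h3 : ∫ h in ball a 1, (φ h + c) ≤ ∫ h in ball 0 (1 + δ), (φ h + c) := by
    refine setIntegral_mono_set (hφc.integrableOn_ball _ _) ?_ hsub1.eventuallyLE
    refine (ae_restrict_iff' measurableSet_ball).2 (.of_forall fun h hh => ?_)
    have := (abs_le.1 (hc h (hsub3 hh))).1
    simp only [Pi.zero_apply]
    linarith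
  have h4 : ∫ h in ball 0 (1 + δ), (c - φ h) ≥ ∫ h in ball 0 1, (c - φ h) := by
    refine setIntegral_mono_set ((continuous_const.sub hφ).integrableOn_ball _ _) ?_
      hsub2.eventuallyLE
    refine (ae_restrict_iff' measurableSet_ball).2 (.of_forall fun h hh => ?_)
    have := (abs_le.1 (hc h (hsub3 hh))).2
    simp only [Pi.zero_apply]
    linarith
  have h5 {r : ℝ} (hr : 0 < r) : ∫ h in ball 0 r, (c - φ h) =
      c * (r ^ N * ω) - ∫ h in ball 0 r, φ h := by
    rw [integral_sub (hconst 0 r) (hφ.integrableOn_ball 0 r), setIntegral_const,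
      volume_real_ball _ hr, smul_eq_mul, mul_comm c]
  rw [h2 a one_pos, h2 0 (by linarith)] at h3
  rw [h5 (by linarith), h5 one_pos] at h4
  have h6 := one_add_pow_le N hδ0 hδ
  have h7 : c * ω * (1 + δ) ^ N ≤ c * ω * (1 + 3 ^ N * δ) :=
    mul_le_mul_of_nonneg_left h6 (mul_nonneg hc0 measureReal_nonneg)
  rw [h1]
  simp only [one_pow, one_mul] at h3 h4
  nlinarith

lemma setIntegral_ball_le_of_add_neg_le (hφ : Continuous φ) (hneg : ∀ h, φ h + φ (-h) ≤ 0)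
    {b : EuclideanSpace ℝ (Fin N)} {t κ : ℝ} (ht : 0 < t) (hb : ball b t ⊆ ball 0 1)
    (hκ : ∀ h ∈ ball b t, φ h + φ (-h) ≤ -κ) :
    2 * ∫ h in ball 0 1, φ h ≤
      -κ * (t ^ N * volume.real (ball (0 : EuclideanSpace ℝ (Fin N)) 1)) := by
  have hpre : (fun h : EuclideanSpace ℝ (Fin N) => -h) ⁻¹' ball 0 1 = ball 0 1 := by
    ext h
    simp
  have h1 : ∫ h in ball 0 1, φ (-h) = ∫ h in ball 0 1, φ h := by
    conv_rhs => rw [← (Measure.measurePreserving_neg volume).setIntegral_preimage_emb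
      (MeasurableEquiv.neg _).measurableEmbedding, hpre]
  have hφn : Continuous fun h => φ (-h) := by fun_prop
  have h2 : ∫ h in ball 0 1, -(φ h + φ (-h)) = -(2 * ∫ h in ball 0 1, φ h) := by
    rw [integral_neg, integral_add (hφ.integrableOn_ball _ _) (hφn.integrableOn_ball _ _), h1]
    ring
  have h3 : ∫ h in ball b t, -(φ h + φ (-h)) ≤ ∫ h in ball 0 1, -(φ h + φ (-h)) :=
    setIntegral_mono_set ((hφ.add hφn).neg.integrableOn_ball _ _)
      (.of_forall fun h => neg_nonneg.2 (hneg h)) hb.eventuallyLE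
  have h4 : κ * volume.real (ball b t) ≤ ∫ h in ball b t, -(φ h + φ (-h)) :=
    setIntegral_ge_of_const_le_real measurableSet_ball measure_ball_lt_top.ne
      (fun h hh => le_neg.1 (hκ h hh)) ((hφ.add hφn).neg.integrableOn_ball _ _)
  rw [volume_real_ball b ht] at h4
  linarith

lemma integral_oddPow_one_sub_exp_nonpos {q y δ : ℝ} (hq : 0 < q) (hy : 0 < y) (hy4 : y ≤ 1 / 4)
    (hδ : 0 ≤ δ) (hδ1 : δ ≤ 1) (hδy : 16 ^ q * 4 * 12 ^ N * δ ≤ q * y)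
    {e : EuclideanSpace ℝ (Fin N)} (he : ‖e‖ = 1) :
    ∫ h in ball 0 1, oddPow q (1 - Real.exp (-2 * y * (inner ℝ e h + δ))) ≤ 0 := by
  set ω := volume.real (ball (0 : EuclideanSpace ℝ (Fin N)) 1) with hω
  set φ : EuclideanSpace ℝ (Fin N) → ℝ :=
    fun h => oddPow q (1 - Real.exp (-2 * y * inner ℝ e h)) with hφdef
  have hφ : Continuous φ := (continuous_oddPow hq).comp (by fun_prop)
  have hinner (h : EuclideanSpace ℝ (Fin N)) : |inner ℝ e h| ≤ ‖h‖ := by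
    simpa [he] using abs_real_inner_le_norm e h
  have h1 : ∫ h in ball 0 1, oddPow q (1 - Real.exp (-2 * y * (inner ℝ e h + δ))) =
      ∫ h in ball 0 1, φ (h + δ • e) := by
    simp only [hφdef, inner_add_right, inner_smul_right, real_inner_self_eq_norm_sq, he]
    norm_num
  have h2 := setIntegral_ball_add_le hφ (c := (8 * y) ^ q) (fun h hh =>
    abs_oddPow_one_sub_exp_le hq hy hy4 ((hinner h).trans (by simpa using hh)))
    (a := δ • e) (by rw [norm_smul, he, mul_one, Real.norm_eq_abs, abs_of_nonneg hδ]) hδ1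
  have h3 := setIntegral_ball_le_of_add_neg_le hφ (b := (3 / 4 : ℝ) • e) (t := 1 / 4)
    (κ := q * y * (y / 2) ^ q) (fun h => by
      simpa only [hφdef, inner_neg_right] using oddPow_one_sub_exp_add_nonpos hq hy (inner ℝ e h))
    (by norm_num) (ball_subset_ball' (by
      rw [dist_zero_right, norm_smul, he]
      norm_num))
    (fun h hh => by
      simp only [hφdef, inner_neg_right]
      refine oddPow_one_sub_exp_add_le hq hy (by linarith) ?_
      have h4 := (hinner (h - (3 / 4 : ℝ) • e)).trans (mem_ball_iff_norm.1 hh).le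
      rw [inner_sub_right, inner_smul_right, real_inner_self_eq_norm_sq, he] at h4
      linarith [(abs_le.1 h4).1])
  rw [h1]
  have e1 : (8 * y) ^ q = 16 ^ q * (y / 2) ^ q := by
    rw [← Real.mul_rpow (by norm_num) (by positivity)]
    congr 1
    ring
  have e2 : (12 : ℝ) ^ N = 3 ^ N * 4 ^ N := by rw [← mul_pow]; norm_num
  have e3 : (1 / 4 : ℝ) ^ N * 4 ^ N = 1 := by rw [← mul_pow]; norm_num
  have key : 4 * (8 * y) ^ q * (3 ^ N * δ) ≤ q * y * (y / 2) ^ q * (1 / 4) ^ N := by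
    calc 4 * (8 * y) ^ q * (3 ^ N * δ)
        = (16 ^ q * 4 * 12 ^ N * δ) * ((y / 2) ^ q * (1 / 4) ^ N) := by
          rw [e1, e2]
          linear_combination (-(4 * 16 ^ q * (y / 2) ^ q * 3 ^ N * δ)) * e3
      _ ≤ q * y * ((y / 2) ^ q * (1 / 4) ^ N) := by gcongr
      _ = _ := by ring
  have := mul_le_mul_of_nonneg_right key (measureReal_nonneg : 0 ≤ ω)
  linarith

end BallIntegrals

section ExteriorSphere

variable {N : ℕ} {p : ℝ≥0∞} {ε : ℝ} {Ω : Set (EuclideanSpace ℝ (Fin N))}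

lemma two_le_exp_neg_mul {y s : ℝ} (hy : 0 ≤ y) (hy4 : y ≤ 1 / 4) (hs : s ≤ y ^ 2) :
    2 ≤ Real.exp (-s) * (Real.exp (2 * y) + Real.exp (-(2 * y))) := by
  have h1 : 2 + 4 * y ^ 2 ≤ Real.exp (2 * y) + Real.exp (-(2 * y)) := by
    have h := Real.self_le_sinh_iff.2 hy
    rw [Real.sinh_eq] at h
    have e1 : Real.exp y * Real.exp (-y) = 1 := by rw [← Real.exp_add]; simp
    have e2 : Real.exp (2 * y) = Real.exp y * Real.exp y := by rw [← Real.exp_add]; ring_nf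
    have e3 : Real.exp (-(2 * y)) = Real.exp (-y) * Real.exp (-y) := by
      rw [← Real.exp_add]; ring_nf
    nlinarith
  have h2 : 1 - y ^ 2 ≤ Real.exp (-s) := by linarith [Real.add_one_le_exp (-s)]
  have h3 : 0 ≤ 1 - 2 * y ^ 2 := by nlinarith
  calc (2 : ℝ) ≤ (1 - y ^ 2) * (2 + 4 * y ^ 2) := by nlinarith [mul_nonneg (sq_nonneg y) h3]
    _ ≤ _ := mul_le_mul h2 h1 (by positivity) (Real.exp_pos _).le

lemma exists_meanLE_one_sub_exp (N : ℕ) (hp : 1 < p) :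
    ∃ K > 0, ∀ (y δ : ℝ) (e : EuclideanSpace ℝ (Fin N)), 0 < y → y ≤ 1 / 4 → 0 ≤ δ → δ ≤ 1 →
      K * δ ≤ y → ‖e‖ = 1 →
        MeanLE p (fun h => 1 - Real.exp (-2 * y * (inner ℝ e h + δ))) 0 := by
  rcases eq_or_ne p ⊤ with rfl | hpt
  · refine ⟨2, two_pos, fun y δ e hy hy4 hδ hδ1 hδy he => ⟨fun _ h hh => ?_, by simp⟩⟩
    refine ⟨-e, by simp [he], ?_⟩
    have h1 : inner ℝ e h ≤ 1 := by
      have := real_inner_le_norm e h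
      rw [he, one_mul] at this
      exact this.trans (by simpa using hh)
    have h2 : inner ℝ e (-e) = (-1 : ℝ) := by
      rw [inner_neg_right, real_inner_self_eq_norm_sq, he, one_pow]
    have h3 : Real.exp (-2 * y * (1 + δ)) ≤ Real.exp (-2 * y * (inner ℝ e h + δ)) :=
      Real.exp_le_exp.2 (by nlinarith)
    have h4 := two_le_exp_neg_mul hy.le hy4 (s := 2 * y * δ) (by nlinarith)
    rw [mul_add, ← Real.exp_add, ← Real.exp_add] at h4
    simp only [h2]
    ring_nf at h3 h4 ⊢
    linarith
  · have hq := toReal_sub_one_pos hp hpt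
    set q := p.toReal - 1 with hqdef
    refine ⟨16 ^ q * 4 * 12 ^ N / q, by positivity, fun y δ e hy hy4 hδ hδ1 hδy he =>
      ⟨fun h => absurd h hpt, fun _ => ?_⟩⟩
    simp only [sub_zero]
    refine ⟨integrable_comp_of_continuousOn (g := oddPow q) (Continuous.continuousOn (by fun_prop))
      (continuous_oddPow hq), integral_oddPow_one_sub_exp_nonpos hq hy hy4 hδ hδ1 ?_ he⟩
    rw [div_mul_eq_mul_div, div_le_iff₀ hq] at hδy
    linarith

/-- The radial barrier vanishing on the sphere of radius `R` centred at `y₀`. -/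
def sphereBarrier (lam R : ℝ) (y₀ x : EuclideanSpace ℝ (Fin N)) : ℝ :=
  Real.exp (-lam * R ^ 2) - Real.exp (-lam * ‖x - y₀‖ ^ 2)

lemma continuous_sphereBarrier (lam R : ℝ) (y₀ : EuclideanSpace ℝ (Fin N)) :
    Continuous (sphereBarrier lam R y₀) := by
  unfold sphereBarrier
  fun_prop

lemma exists_meanLE_sphereBarrier (N : ℕ) (hp : 1 < p) {R : ℝ} (hR : 0 < R) :
    ∃ lam > 0, ∀ (y₀ x : EuclideanSpace ℝ (Fin N)) (r : ℝ), R ≤ ‖x - y₀‖ → 0 < r → r ≤ R →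
      lam * ‖x - y₀‖ * r ≤ 1 / 4 →
        MeanLE p (fun h => sphereBarrier lam R y₀ (x + r • h)) (sphereBarrier lam R y₀ x) := by
  obtain ⟨K, hK, H⟩ := exists_meanLE_one_sub_exp N hp
  refine ⟨K / (2 * R ^ 2), by positivity, fun y₀ x r hρ hr hrR hlam => ?_⟩
  set lam := K / (2 * R ^ 2) with hlamdef
  have hlam0 : 0 < lam := by positivity
  have hlamR : K = 2 * lam * R ^ 2 := by
    rw [hlamdef]
    field_simp
  set ρ := ‖x - y₀‖ with hρdef
  have hρ0 : 0 < ρ := hR.trans_le hρ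
  have hnorm : ‖ρ⁻¹ • (x - y₀)‖ = 1 := by
    rw [norm_smul, ← hρdef, Real.norm_eq_abs, abs_of_pos (by positivity)]
    field_simp
  have hmean := H (lam * ρ * r) (r / (2 * ρ)) (ρ⁻¹ • (x - y₀)) (by positivity) hlam
    (by positivity) (by rw [div_le_one (by positivity)]; linarith) (by
      rw [hlamR, mul_div_assoc', div_le_iff₀ (by positivity)]
      have : R ^ 2 ≤ ρ ^ 2 := by gcongr
      calc 2 * lam * R ^ 2 * r ≤ 2 * lam * ρ ^ 2 * r := by gcongr
        _ = _ := by ring) hnorm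
  have hmean' := hmean.affine (sphereBarrier lam R y₀ x) (Real.exp_pos (-lam * ρ ^ 2)).le
  rw [mul_zero, add_zero] at hmean'
  refine hmean'.of_le hp ((continuous_sphereBarrier lam R y₀).comp (by fun_prop)).continuousOn
    fun h hh => ?_
  have hh1 : ‖h‖ ≤ 1 := by simpa using hh
  have h1 : ‖x + r • h - y₀‖ ^ 2 ≤ ρ ^ 2 + 2 * r * inner ℝ (x - y₀) h + r ^ 2 := by
    rw [add_sub_right_comm, norm_add_sq_real, inner_smul_right, norm_smul, Real.norm_eq_abs,
      abs_of_pos hr, mul_pow]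
    have : ‖h‖ ^ 2 ≤ 1 := pow_le_one₀ (norm_nonneg _) hh1
    nlinarith [mul_le_mul_of_nonneg_left this (sq_nonneg r)]
  have h2 : Real.exp (-lam * ρ ^ 2) * Real.exp (-2 * (lam * ρ * r) *
      (inner ℝ (ρ⁻¹ • (x - y₀)) h + r / (2 * ρ))) ≤ Real.exp (-lam * ‖x + r • h - y₀‖ ^ 2) := by
    rw [← Real.exp_add, real_inner_smul_left]
    refine Real.exp_le_exp.2 ?_
    calc -lam * ρ ^ 2 + -2 * (lam * ρ * r) * (ρ⁻¹ * inner ℝ (x - y₀) h + r / (2 * ρ))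
        = -(lam * (ρ ^ 2 + 2 * r * inner ℝ (x - y₀) h + r ^ 2)) := by
          field_simp
          ring
      _ ≤ -lam * ‖x + r • h - y₀‖ ^ 2 := by
          rw [neg_mul, neg_le_neg_iff]
          gcongr
  rw [mul_sub, mul_one]
  simp only [sphereBarrier, ← hρdef, Function.comp_apply]
  linarith

lemma IsBoundedDomain.le_norm_sub_of_exteriorSphere (hΩ : IsBoundedDomain Ω) {R : ℝ}
    {x₀ y₀ : EuclideanSpace ℝ (Fin N)} (hx₀ : x₀ ∈ frontier Ω)
    (hy₀ : closedBall y₀ R ∩ closure Ω = {x₀}) :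
    ‖x₀ - y₀‖ = R ∧ ∀ x ∈ closure Ω, x ≠ x₀ → R < ‖x - y₀‖ := by
  have hmem : x₀ ∈ closedBall y₀ R ∩ closure Ω := by rw [hy₀]; rfl
  refine ⟨(mem_closedBall_iff_norm.1 hmem.1).antisymm (le_of_not_gt fun hlt => ?_),
    fun x hx hne => lt_of_not_ge fun hle => hne ?_⟩
  · obtain ⟨z, hz, hzΩ⟩ := mem_closure_iff.1 hmem.2 _ isOpen_ball (mem_ball_iff_norm.2 hlt)
    have : z ∈ closedBall y₀ R ∩ closure Ω := ⟨ball_subset_closedBall hz, subset_closure hzΩ⟩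
    rw [hy₀, Set.mem_singleton_iff] at this
    exact hΩ.notMem_of_mem_frontier hx₀ (this ▸ hzΩ)
  · have : x ∈ closedBall y₀ R ∩ closure Ω := ⟨mem_closedBall_iff_norm.2 hle, hx⟩
    rwa [hy₀] at this

/-- Under a uniform exterior sphere condition all boundary points are regular for small `ε`. -/
lemma IsBoundedDomain.exists_isBarrier (hΩ : IsBoundedDomain Ω) (hp : 1 < p) {R : ℝ} (hR : 0 < R)
    (hsphere : ∀ x₀ ∈ frontier Ω, ∃ y₀, closedBall y₀ R ∩ closure Ω = {x₀}) :
    ∃ ε₁ > 0, ∀ ε, 0 < ε → ε < ε₁ → ∀ x₀ ∈ frontier Ω, ∃ w, IsBarrier p ε Ω x₀ w := by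
  obtain ⟨lam, hlam, H⟩ := exists_meanLE_sphereBarrier N hp hR
  have hD : 0 < diam (closure Ω) + R := add_pos_of_nonneg_of_pos diam_nonneg hR
  refine ⟨min R (1 / (4 * (lam * (diam (closure Ω) + R)))), by positivity,
    fun ε hε hε1 x₀ hx₀ => ?_⟩
  obtain ⟨y₀, hy₀⟩ := hsphere x₀ hx₀
  obtain ⟨hR₀, hout⟩ := hΩ.le_norm_sub_of_exteriorSphere hx₀ hy₀
  have hc := (continuous_sphereBarrier lam R y₀).continuousOn (s := closure Ω)
  refine ⟨sphereBarrier lam R y₀, hc, fun x hx => ?_, fun x hx hne => ?_, ?_⟩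
  · have hx' := subset_closure hx
    have hr := hΩ.rEps_pos hε hx
    have hrε : rEps ε Ω x ≤ ε := min_le_left _ _
    have hne : x ≠ x₀ := fun h => hΩ.notMem_frontier hx (h ▸ hx₀)
    have hdist : ‖x - y₀‖ ≤ diam (closure Ω) + R := by
      have h1 := dist_le_diam_of_mem hΩ.isCompact_closure.isBounded hx'
        (frontier_subset_closure hx₀)
      have h2 := dist_triangle x x₀ y₀
      rw [dist_eq_norm x y₀, dist_eq_norm x₀ y₀, hR₀] at h2
      linarith
    rw [hΩ.muEps_le_iff hp hε hc hx']
    refine H y₀ x _ (hout x hx' hne).le hr (hrε.trans (hε1.le.trans (min_le_left _ _))) ?_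
    have h3 := hrε.trans (hε1.le.trans (min_le_right _ _))
    rw [le_div_iff₀ (by positivity)] at h3
    have h4 : lam * ‖x - y₀‖ * rEps ε Ω x ≤ lam * (diam (closure Ω) + R) * rEps ε Ω x := by
      gcongr
    linarith
  · have h := hout x hx hne
    simp only [sphereBarrier, sub_pos, Real.exp_lt_exp, neg_mul, neg_lt_neg_iff]
    gcongr
  · simp [sphereBarrier, hR₀]

end ExteriorSphere

lemma IsBoundedDomain.of_nonempty {N : ℕ} (hN : 0 < N) {Ω : Set (EuclideanSpace ℝ (Fin N))}
    (hΩo : IsOpen Ω) (hΩb : Bornology.IsBounded Ω) (hΩne : Ω.Nonempty) : IsBoundedDomain Ω := by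
  have : Nonempty (Fin N) := ⟨⟨0, hN⟩⟩
  refine ⟨hΩo, hΩb, nonempty_frontier_iff.2 ⟨hΩne, fun h => ?_⟩⟩
  exact NormedSpace.unbounded_univ ℝ (EuclideanSpace ℝ (Fin N)) (h ▸ hΩb)

/-- Corollary 4.3: if the bounded domain `Ω` satisfies a uniform exterior
sphere condition and `1 < p ≤ ∞`, then there exists `ε_Γ ∈ (0, ε₀]` such that for every
`0 < ε < ε_Γ` all boundary points are regular; in particular, for every `g ∈ C(Γ)`, the
Dirichlet-type problem has a unique solution `u^ε = u̲^ε = u̅^ε ∈ C(closure Ω)`. -/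
theorem exterior_sphere_regularity {N : ℕ} (hN : 0 < N) (p : ℝ≥0∞) (hp : 1 < p)
    (Ω : Set (EuclideanSpace ℝ (Fin N))) (hΩo : IsOpen Ω) (hΩc : IsPreconnected Ω)
    (hΩb : Bornology.IsBounded Ω) (hΩne : Ω.Nonempty)
    (ε₀ : ℝ) (hε₀ : 0 < ε₀) (z : EuclideanSpace ℝ (Fin N)) (hball : Metric.ball z ε₀ ⊆ Ω)
    (R : ℝ) (hR : 0 < R)
    (hsphere : ∀ x₀ ∈ frontier Ω, ∃ y₀ : EuclideanSpace ℝ (Fin N),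
      Metric.closedBall y₀ R ∩ closure Ω = {x₀}) :
    ∃ εΓ : ℝ, 0 < εΓ ∧ εΓ ≤ ε₀ ∧ ∀ ε : ℝ, 0 < ε → ε < εΓ →
      (∀ x₀ ∈ frontier Ω, ∃ w, IsBarrier p ε Ω x₀ w) ∧
      (∀ g : EuclideanSpace ℝ (Fin N) → ℝ, ContinuousOn g (frontier Ω) →
        (∃ u, IsDirichletSolution p ε Ω g u ∧
          Set.EqOn u (lowerPerron p ε Ω g) (closure Ω) ∧
          Set.EqOn u (upperPerron p ε Ω g) (closure Ω)) ∧
        (∀ u₁ u₂, IsDirichletSolution p ε Ω g u₁ → IsDirichletSolution p ε Ω g u₂ →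
          Set.EqOn u₁ u₂ (closure Ω))) := by
  have hΩ := IsBoundedDomain.of_nonempty hN hΩo hΩb hΩne
  obtain ⟨ε₁, hε₁, hbar⟩ := hΩ.exists_isBarrier hp hR hsphere
  refine ⟨min ε₀ ε₁, lt_min hε₀ hε₁, min_le_left _ _, fun ε hε hlt => ?_⟩
  have hreg := hbar ε hε (hlt.trans_le (min_le_right _ _))
  refine ⟨hreg, fun g hg => ⟨?_, fun u₁ u₂ h₁ h₂ =>
    (h₁.eqOn_lowerPerron hΩ hp hε).trans (h₂.eqOn_lowerPerron hΩ hp hε).symm⟩⟩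
  obtain ⟨u, hu⟩ := hΩ.exists_isDirichletSolution hp hε hreg hg
  exact ⟨u, hu, hu.eqOn_lowerPerron hΩ hp hε, hu.eqOn_upperPerron hΩ hp hε⟩
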